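/- arXiv:1312.5634 — 3 statements merged into one kernel-verified Lean document; each statement's English description precedes it below -/
import Mathlib

section
/- The matrix P(a,b) = [[1-a,1+a,1+a,1-a],[1-b,1-b,1+b,1+b],[1+a,1-a,1-a,1+a],[1+b,1+b,1-b,1-b]] with 0 ≤ a,b < 1 has nonnegative rank at most 3 if and only if ab + a + b ≤ 1. -/
/-- Edge condition: the rectangle lies to the left of the directed edge. -/
def EdgeC (a b x y x' y' : ℝ) : Prop :=
  a * (y - y') + b * (x - x') ≤ x * y' - x' * y ∧
  a * (y - y') + b * (x' - x) ≤ x * y' - x' * y ∧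
  a * (y' - y) + b * (x - x') ≤ x * y' - x' * y ∧
  a * (y' - y) + b * (x' - x) ≤ x * y' - x' * y

def InSq (x y : ℝ) : Prop := -1 ≤ x ∧ x ≤ 1 ∧ -1 ≤ y ∧ y ≤ 1

def TriC (a b x1 y1 x2 y2 x3 y3 : ℝ) : Prop :=
  (0 < a ∧ a < 1 ∧ 0 < b ∧ b < 1 ∧ 1 < a * b + a + b) ∧
  (InSq x1 y1 ∧ InSq x2 y2 ∧ InSq x3 y3) ∧
  (EdgeC a b x1 y1 x2 y2 ∧ EdgeC a b x2 y2 x3 y3 ∧ EdgeC a b x3 y3 x1 y1) ∧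
  0 < (x1 * y2 - x2 * y1) + (x2 * y3 - x3 * y2) + (x3 * y1 - x1 * y3)

theorem TriC.cyc {a b x1 y1 x2 y2 x3 y3 : ℝ} (h : TriC a b x1 y1 x2 y2 x3 y3) :
    TriC a b x2 y2 x3 y3 x1 y1 := by
  obtain ⟨h1, ⟨h2, h3, h4⟩, ⟨h5, h6, h7⟩, h8⟩ := h
  exact ⟨h1, ⟨h3, h4, h2⟩, ⟨h6, h7, h5⟩, by linarith⟩

theorem EdgeC.rot {a b x y x' y' : ℝ} (h : EdgeC a b x y x' y') :
    EdgeC b a (-y) x (-y') x' := by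
  obtain ⟨h1, h2, h3, h4⟩ := h
  refine ⟨?_, ?_, ?_, ?_⟩ <;> linarith

theorem InSq.rot {x y : ℝ} (h : InSq x y) : InSq (-y) x := by
  obtain ⟨h1, h2, h3, h4⟩ := h
  refine ⟨?_, ?_, ?_, ?_⟩ <;> linarith

theorem TriC.rot {a b x1 y1 x2 y2 x3 y3 : ℝ} (h : TriC a b x1 y1 x2 y2 x3 y3) :
    TriC b a (-y1) x1 (-y2) x2 (-y3) x3 := by
  obtain ⟨⟨g1, g2, g3, g4, g5⟩, ⟨h2, h3, h4⟩, ⟨h5, h6, h7⟩, h8⟩ := h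
  exact ⟨⟨g3, g4, g1, g2, by linarith⟩, ⟨h2.rot, h3.rot, h4.rot⟩, ⟨h5.rot, h6.rot, h7.rot⟩,
    by linarith⟩

theorem TriC.rot3 {a b x1 y1 x2 y2 x3 y3 : ℝ} (h : TriC a b x1 y1 x2 y2 x3 y3) :
    TriC b a y1 (-x1) y2 (-x2) y3 (-x3) := by
  simpa using h.rot.rot.rot

/-- clockwise turn, impossible -/
theorem K1 {a b x1 y1 x2 y2 x3 y3 : ℝ} (h : TriC a b x1 y1 x2 y2 x3 y3)
    (_ : 0 ≤ x1) (_ : 0 ≤ y1) (_ : 0 ≤ x2) (_ : 0 ≤ -y2) : False := by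
  obtain ⟨⟨ha, _, hb, _, _⟩, _, ⟨⟨e1, e2, e3, e4⟩, _, _⟩, h8⟩ := h
  have c1 : 0 ≤ x1 * (-y2) := by positivity
  have c2 : 0 ≤ x2 * y1 := by positivity
  have hx : x1 = x2 := by
    apply le_antisymm <;> by_contra! hh
    · nlinarith [mul_pos hb (sub_pos.2 hh)]
    · nlinarith [mul_pos hb (sub_pos.2 hh)]
  have hy : y1 = y2 := by
    apply le_antisymm <;> by_contra! hh
    · nlinarith [mul_pos ha (sub_pos.2 hh)]
    · nlinarith [mul_pos ha (sub_pos.2 hh)]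
  subst hx hy
  linarith

/-- all in one quadrant -/
theorem K4 {a b x1 y1 x2 y2 x3 y3 : ℝ} (h : TriC a b x1 y1 x2 y2 x3 y3)
    (i1 : 0 ≤ x1) (i2 : 0 ≤ x2) (i3 : 0 ≤ x3) : False := by
  obtain ⟨⟨ha, _, hb, _, _⟩, _, ⟨⟨e1, e2, e3, e4⟩, ⟨f1, f2, f3, f4⟩, ⟨g1, g2, g3, g4⟩⟩, h8⟩ := h
  have q3 := mul_nonneg i3 (sub_nonneg.2 e1)
  have q1 := mul_nonneg i1 (sub_nonneg.2 f1)
  have q2 := mul_nonneg i2 (sub_nonneg.2 g1)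
  have q3' := mul_nonneg i3 (sub_nonneg.2 e2)
  have q1' := mul_nonneg i1 (sub_nonneg.2 f2)
  have q2' := mul_nonneg i2 (sub_nonneg.2 g2)
  have q3'' := mul_nonneg i3 (sub_nonneg.2 e3)
  have q1'' := mul_nonneg i1 (sub_nonneg.2 f3)
  have q2'' := mul_nonneg i2 (sub_nonneg.2 g3)
  have q3''' := mul_nonneg i3 (sub_nonneg.2 e4)
  have q1''' := mul_nonneg i1 (sub_nonneg.2 f4)
  have q2''' := mul_nonneg i2 (sub_nonneg.2 g4)
  have := mul_pos ha h8
  nlinarith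

theorem L0 {a b X Y u w : ℝ} (ha : 0 < a) (hb : 0 < b) (hX : 0 ≤ X) (hY : 0 ≤ Y)
    (hu : 0 ≤ u) (hw : 0 ≤ w) (h : (u + b) * (w + a) ≤ (X - a) * (Y - b)) :
    (a < X ∧ b < Y) ∨ (X = 0 ∧ Y = 0 ∧ u = 0 ∧ w = 0) := by
  have huw := mul_nonneg hu hw
  have hau := mul_nonneg ha.le hu
  have hbw := mul_nonneg hb.le hw
  by_cases h1 : a < X
  · left
    refine ⟨h1, ?_⟩
    by_contra! h2
    have := mul_nonneg (sub_nonneg.2 h1.le) (sub_nonneg.2 h2)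
    nlinarith [mul_pos ha hb]
  · right
    push Not at h1
    have t1 := mul_nonneg (sub_nonneg.2 h1) hY
    have t2 := mul_nonneg hb.le hX
    have hX0 : X = 0 := by
      have : b * X = 0 := by nlinarith
      rcases mul_eq_zero.1 this with h | h
      · linarith
      · exact h
    subst hX0
    have hau0 : a * u = 0 := by nlinarith
    have hbw0 : b * w = 0 := by nlinarith
    have haY0 : a * Y = 0 := by nlinarith
    refine ⟨rfl, ?_, ?_, ?_⟩
    · exact (mul_eq_zero.1 haY0).resolve_left ha.ne'
    · exact (mul_eq_zero.1 hau0).resolve_left ha.ne'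
    · exact (mul_eq_zero.1 hbw0).resolve_left hb.ne'

theorem F1 {a b X p q μ ν Y : ℝ} (ha : 0 < a) (hb : 0 < b) (ha1 : a < 1) (hb1 : b < 1)
    (hX1 : X ≤ 1) (hY1 : Y ≤ 1) (hq1 : q ≤ 1)
    (hqb : b < q) (hpa : a < p) (hμ : 0 < μ) (hν : 0 < ν)
    (E1 : μ * (p + a) ≤ (X - a) * (q - b)) (E2 : ν * (q + b) ≤ (Y - b) * (p - a)) :
    2 * b * (μ * ν) ≤ ((1 - a) * (1 - b) - μ * ν - 2 * a * μ) * (1 - b) := by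
  have E1' : μ * (p + a) ≤ (1 - a) * (q - b) := by nlinarith
  have E2' : ν * (q + b) ≤ (1 - b) * (p - a) := by nlinarith
  have h1 := mul_le_mul_of_nonneg_left E1' (sub_nonneg.2 hb1.le)
  have h2 := mul_le_mul_of_nonneg_left E2' hμ.le
  set D := (1 - a) * (1 - b) with hD
  have hDp : 0 < D := mul_pos (by linarith) (by linarith)
  have hz := mul_pos hμ hν
  have h3 : b * D + μ * ν * b + 2 * a * μ * (1 - b) ≤ (D - μ * ν) * q := by
    rw [hD]; nlinarith
  have h4 : 0 < b * D + μ * ν * b + 2 * a * μ * (1 - b) := by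
    have : 0 < 1 - b := by linarith
    positivity
  have h5 : 0 < D - μ * ν := by
    by_contra! h
    nlinarith
  nlinarith

set_option maxHeartbeats 1000000 in
theorem core {a b X Y p q μ ν : ℝ} (ha : 0 < a) (hb : 0 < b) (ha1 : a < 1) (hb1 : b < 1)
    (hX : a < X) (hX1 : X ≤ 1) (hY : b < Y) (hY1 : Y ≤ 1) (hp : 0 ≤ p) (hp1 : p ≤ 1)
    (hq : 0 ≤ q) (hq1 : q ≤ 1) (hμ : 0 < μ) (hν : 0 < ν)
    (E1 : μ * (p + a) ≤ (X - a) * (q - b)) (E2 : ν * (q + b) ≤ (Y - b) * (p - a))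
    (E3 : (2 * b - μ) * (2 * a - ν) ≤ (X - a) * (Y - b) ∨ (b ≤ μ ∧ a ≤ ν)) :
    a * b + a + b ≤ 1 := by
  have hqb : b < q := by
    have : 0 < μ * (p + a) := by positivity
    by_contra! h
    nlinarith
  have hpa : a < p := by
    have : 0 < ν * (q + b) := by positivity
    by_contra! h
    nlinarith
  have f1 := F1 ha hb ha1 hb1 hX1 hY1 hq1 hqb hpa hμ hν E1 E2
  have f2 := F1 hb ha hb1 ha1 hY1 hX1 hp1 hpa hqb hν hμ E2 E1
  have hXY : (X - a) * (Y - b) ≤ (1 - a) * (1 - b) :=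
    mul_le_mul (by linarith) (by linarith) (by linarith) (by linarith)
  have hz := mul_pos hμ hν
  by_contra! hcon
  have hDK : (1 - a) * (1 - b) < 2 * a * b := by nlinarith
  rw [show (1 - b) * (1 - a) = (1 - a) * (1 - b) by ring, mul_comm ν μ] at f2
  have hDp : 0 < (1 - a) * (1 - b) := mul_pos (by linarith) (by linarith)
  have hDD : (1 - a) * (1 - b) = (1 - a) * (1 - b) := rfl
  generalize hD : (1 - a) * (1 - b) = D at *
  have hA : 0 < D - μ * ν - 2 * a * μ := by
    have : 0 < 2 * b * (μ * ν) := by positivity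
    by_contra! h
    nlinarith
  have hB : 0 < D - μ * ν - 2 * b * ν := by
    have : 0 < 2 * a * (μ * ν) := by positivity
    by_contra! h
    nlinarith
  rcases E3 with E3 | ⟨E3, _⟩
  swap
  · nlinarith
  have hprod := mul_le_mul f1 f2 (by positivity) (mul_nonneg hA.le (by linarith))
  have hprod2 : 4 * a * b * (μ * ν) ^ 2 ≤
      D * ((D - μ * ν - 2 * a * μ) * (D - μ * ν - 2 * b * ν)) := by
    rw [← hD] at hprod ⊢; nlinarith
  set K := 2 * a * b with hK
  have hKp : 0 < K := by positivity
  set s := 2 * a * μ with hs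
  set t := 2 * b * ν with ht
  set z := μ * ν with hzz
  have hst : s * t = 2 * K * z := by rw [hs, ht, hK, hzz]; ring
  have h4 : K + z < s + t := by
    have : (2 * b - μ) * (2 * a - ν) = 2 * K - s - t + z := by rw [hs, ht, hK, hzz]; ring
    linarith
  have g1 : (D - z - s) * (D - z - t) ≤ (K - z - s) * (K - z - t) :=
    mul_le_mul (by linarith) (by linarith) hB.le (by linarith)
  have g2 : (K - z - s) * (K - z - t) ≤ (t - 2 * z) * (s - 2 * z) :=
    mul_le_mul (by linarith) (by linarith) (by linarith) (by linarith)
  have g3 : (t - 2 * z) * (s - 2 * z) < 2 * z ^ 2 := by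
    have k1 := mul_lt_mul_of_pos_left h4 hz
    have k2 : (t - 2 * z) * (s - 2 * z) = s * t - 2 * (z * (s + t)) + 4 * z ^ 2 := by ring
    have k3 : z * (K + z) = K * z + z ^ 2 := by ring
    rw [k2, hst]
    linarith
  have g4 : (D - z - s) * (D - z - t) < 2 * z ^ 2 := by linarith
  have g5 : 0 < (D - z - s) * (D - z - t) := mul_pos hA hB
  have g6 : D * ((D - z - s) * (D - z - t)) < K * (2 * z ^ 2) :=
    mul_lt_mul hDK g4.le g5 hKp.le
  have : 4 * a * b * z ^ 2 = K * (2 * z ^ 2) := by rw [hK]; ring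
  linarith

theorem K2 {a b x1 y1 x2 y2 x3 y3 : ℝ} (h : TriC a b x1 y1 x2 y2 x3 y3)
    (i1 : 0 ≤ x1) (i2 : 0 ≤ -y1) (i3 : 0 ≤ -x2) (i4 : 0 ≤ y2) (i5 : 0 ≤ -x3) (i6 : 0 ≤ -y3) :
    False := by
  obtain ⟨⟨ha, ha1, hb, hb1, hab⟩, ⟨⟨s1, s2, s3, s4⟩, ⟨s5, s6, s7, s8⟩, ⟨s9, s10, s11, s12⟩⟩,
    ⟨⟨e1, e2, e3, e4⟩, ⟨f1, f2, f3, f4⟩, ⟨g1, g2, g3, g4⟩⟩, h8⟩ := h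
  have E3 : (-y1 + b) * (-x2 + a) ≤ (x1 - a) * (y2 - b) := by nlinarith
  rcases L0 ha hb i1 i4 i2 i3 E3 with ⟨hX, hY⟩ | ⟨r1, r2, r3, r4⟩
  · have hXY : (x1 - a) * (y2 - b) ≤ (1 - a) * (1 - b) :=
      mul_le_mul (by linarith) (by linarith) (by linarith) (by linarith)
    rcases le_or_gt (b + y1) 0 with hm | hm
    · have : 2 * b * a ≤ (-y1 + b) * (-x2 + a) :=
        mul_le_mul (by linarith) (by linarith) ha.le (by linarith)
      nlinarith
    rcases le_or_gt (a + x2) 0 with hn | hn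
    · have : b * (2 * a) ≤ (-y1 + b) * (-x2 + a) :=
        mul_le_mul (by linarith) (by linarith) (by linarith) (by linarith)
      nlinarith
    have := core (p := -x3) (q := -y3) ha hb ha1 hb1 hX s2 hY s8 i5 (by linarith) i6 (by linarith)
      hm hn (by nlinarith) (by nlinarith) (Or.inl (by nlinarith))
    linarith
  · have : y1 = 0 := by linarith
    have : x2 = 0 := by linarith
    subst_vars
    linarith

theorem K3 {a b x1 y1 x2 y2 x3 y3 : ℝ} (h : TriC a b x1 y1 x2 y2 x3 y3)
    (i1 : 0 ≤ x1) (i2 : 0 ≤ y1) (i3 : 0 ≤ x2) (i4 : 0 ≤ y2) (i5 : 0 ≤ -x3) (i6 : 0 ≤ -y3) :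
    False := by
  obtain ⟨⟨ha, ha1, hb, hb1, hab⟩, ⟨⟨s1, s2, s3, s4⟩, ⟨s5, s6, s7, s8⟩, ⟨s9, s10, s11, s12⟩⟩,
    ⟨⟨e1, e2, e3, e4⟩, ⟨f1, f2, f3, f4⟩, ⟨g1, g2, g3, g4⟩⟩, h8⟩ := h
  have E1 : (y1 + b) * (-x3 + a) ≤ (x1 - a) * (-y3 - b) := by nlinarith
  have E2 : (-y3 + b) * (x2 + a) ≤ (-x3 - a) * (y2 - b) := by nlinarith
  rcases L0 ha hb i1 i6 i2 i5 E1 with ⟨hX, _⟩ | ⟨r1, r2, r3, r4⟩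
  · rcases L0 ha hb i5 i4 i6 i3 E2 with ⟨_, hY⟩ | ⟨r1, r2, r3, r4⟩
    · have := core (p := -x3) (q := -y3) (μ := b + y1) (ν := a + x2)
        ha hb ha1 hb1 hX s2 hY s8 i5 (by linarith) i6 (by linarith)
        (by linarith) (by linarith) (by nlinarith) (by nlinarith)
        (Or.inr ⟨by linarith, by linarith⟩)
      linarith
    · have : y3 = 0 := by linarith
      have : x3 = 0 := by linarith
      subst_vars
      linarith
  · have : y3 = 0 := by linarith
    have : x3 = 0 := by linarith
    subst_vars
    linarith

set_option maxHeartbeats 1000000 in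
theorem noTri {a b x1 y1 x2 y2 x3 y3 : ℝ} (h : TriC a b x1 y1 x2 y2 x3 y3) : False := by
  have sg : ∀ x : ℝ, (0 ≤ x ∧ 0 ≤ -(-x)) ∨ 0 ≤ -x := fun x => by
    rcases le_total 0 x with h | h
    · left; constructor <;> linarith
    · right; linarith
  have a0 := h
  have a1 := h.rot
  have a2 := h.rot.rot
  have a3 := h.rot3
  have b0 := h.cyc
  have b1 := b0.rot
  have b2 := b0.rot.rot
  have b3 := b0.rot3
  have c0 := b0.cyc
  have c1 := c0.rot
  have c2 := c0.rot.rot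
  have c3 := c0.rot3
  rcases sg x1 with ⟨_, _⟩ | _ <;> rcases sg y1 with ⟨_, _⟩ | _ <;> rcases sg x2 with ⟨_, _⟩ | _ <;>
  rcases sg y2 with ⟨_, _⟩ | _ <;> rcases sg x3 with ⟨_, _⟩ | _ <;> rcases sg y3 with ⟨_, _⟩ | _ <;>
  first
  | (apply K4 a0 <;> assumption)
  | (apply K4 a1 <;> assumption)
  | (apply K4 a2 <;> assumption)
  | (apply K4 a3 <;> assumption)
  | (apply K1 a0 <;> assumption)
  | (apply K1 a1 <;> assumption)
  | (apply K1 a2 <;> assumption)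
  | (apply K1 a3 <;> assumption)
  | (apply K1 b0 <;> assumption)
  | (apply K1 b1 <;> assumption)
  | (apply K1 b2 <;> assumption)
  | (apply K1 b3 <;> assumption)
  | (apply K1 c0 <;> assumption)
  | (apply K1 c1 <;> assumption)
  | (apply K1 c2 <;> assumption)
  | (apply K1 c3 <;> assumption)
  | (apply K2 a0 <;> assumption)
  | (apply K2 a1 <;> assumption)
  | (apply K2 a2 <;> assumption)
  | (apply K2 a3 <;> assumption)
  | (apply K2 b0 <;> assumption)
  | (apply K2 b1 <;> assumption)
  | (apply K2 b2 <;> assumption)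
  | (apply K2 b3 <;> assumption)
  | (apply K2 c0 <;> assumption)
  | (apply K2 c1 <;> assumption)
  | (apply K2 c2 <;> assumption)
  | (apply K2 c3 <;> assumption)
  | (apply K3 a0 <;> assumption)
  | (apply K3 a1 <;> assumption)
  | (apply K3 a2 <;> assumption)
  | (apply K3 a3 <;> assumption)
  | (apply K3 b0 <;> assumption)
  | (apply K3 b1 <;> assumption)
  | (apply K3 b2 <;> assumption)
  | (apply K3 b3 <;> assumption)
  | (apply K3 c0 <;> assumption)
  | (apply K3 c1 <;> assumption)
  | (apply K3 c2 <;> assumption)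
  | (apply K3 c3 <;> assumption)

/-- right multiplier -/
noncomputable def RM (a b : ℝ) : Matrix (Fin 4) (Fin 3) ℝ :=
  !![1/(2*a), 1/(2*b), 1/2; -(1/(2*a)), 0, 0; 0, 0, 1/2; 0, -(1/(2*b)), 0]

noncomputable def LM (a b : ℝ) : Matrix (Fin 3) (Fin 4) ℝ :=
  !![a, -a, -a, a; b, b, -b, -b; 1, 1, 1, 1]

theorem LM_RM {a b : ℝ} (ha : 0 < a) (hb : 0 < b) : LM a b * RM a b = 1 := by
  ext i j
  fin_cases i <;> fin_cases j <;>
    simp [LM, RM, Matrix.mul_apply, Fin.sum_univ_succ] <;> field_simp <;> norm_num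

theorem edge_of {a b x1 y1 x2 y2 x3 y3 : ℝ} {u v w : Fin 4 → ℝ} (hw : ∀ j, 0 ≤ w j)
    (h1 : ∀ j, u j + v j + w j = 1)
    (hx : ∀ j, x1 * u j + x2 * v j + x3 * w j = LM a b 0 j)
    (hy : ∀ j, y1 * u j + y2 * v j + y3 * w j = LM a b 1 j)
    (hd : 0 < (x1 * y2 - x2 * y1) + (x2 * y3 - x3 * y2) + (x3 * y1 - x1 * y3)) :
    EdgeC a b x1 y1 x2 y2 := by
  have key : ∀ j, 0 ≤ (x1 * y2 - x2 * y1) + (x2 * LM a b 1 j - LM a b 0 j * y2)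
      + (LM a b 0 j * y1 - x1 * LM a b 1 j) := by
    intro j
    have := mul_nonneg (hw j) hd.le
    have e : (x1 * y2 - x2 * y1) + (x2 * LM a b 1 j - LM a b 0 j * y2)
      + (LM a b 0 j * y1 - x1 * LM a b 1 j) =
      w j * ((x1 * y2 - x2 * y1) + (x2 * y3 - x3 * y2) + (x3 * y1 - x1 * y3)) := by
      rw [← hx, ← hy]
      have hu : u j = 1 - v j - w j := by linarith [h1 j]
      rw [hu]; ring
    rw [e]; exact this
  have k0 := key 0
  have k1 := key 1
  have k2 := key 2
  have k3 := key 3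
  simp [LM] at k0 k1 k2 k3
  refine ⟨?_, ?_, ?_, ?_⟩ <;> linarith

theorem noPos {a b x1 y1 x2 y2 x3 y3 : ℝ} {u v w : Fin 4 → ℝ}
    (hab : 0 < a ∧ a < 1 ∧ 0 < b ∧ b < 1 ∧ 1 < a * b + a + b)
    (s1 : InSq x1 y1) (s2 : InSq x2 y2) (s3 : InSq x3 y3)
    (hu : ∀ j, 0 ≤ u j) (hv : ∀ j, 0 ≤ v j) (hw : ∀ j, 0 ≤ w j)
    (h1 : ∀ j, u j + v j + w j = 1)
    (hx : ∀ j, x1 * u j + x2 * v j + x3 * w j = LM a b 0 j)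
    (hy : ∀ j, y1 * u j + y2 * v j + y3 * w j = LM a b 1 j)
    (hd : 0 < (x1 * y2 - x2 * y1) + (x2 * y3 - x3 * y2) + (x3 * y1 - x1 * y3)) : False := by
  apply noTri (a := a) (b := b) (x1 := x1) (y1 := y1) (x2 := x2) (y2 := y2) (x3 := x3) (y3 := y3)
  refine ⟨hab, ⟨s1, s2, s3⟩, ⟨?_, ?_, ?_⟩, hd⟩
  · exact edge_of hw h1 hx hy hd
  · exact edge_of (x3 := x1) (y3 := y1) (u := v) (v := w) hu (fun j => by linarith [h1 j])
      (fun j => by linarith [hx j]) (fun j => by linarith [hy j]) (by linarith)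
  · exact edge_of (x3 := x2) (y3 := y2) (u := w) (v := u) hv (fun j => by linarith [h1 j])
      (fun j => by linarith [hx j]) (fun j => by linarith [hy j]) (by linarith)

theorem noN {a b : ℝ} {x y : Fin 3 → ℝ} {w : Fin 3 → Fin 4 → ℝ}
    (hab : 0 < a ∧ a < 1 ∧ 0 < b ∧ b < 1 ∧ 1 < a * b + a + b)
    (s : ∀ k, InSq (x k) (y k)) (hw : ∀ k j, 0 ≤ w k j)
    (h1 : ∀ j, w 0 j + w 1 j + w 2 j = 1)
    (hx : ∀ j, x 0 * w 0 j + x 1 * w 1 j + x 2 * w 2 j = LM a b 0 j)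
    (hy : ∀ j, y 0 * w 0 j + y 1 * w 1 j + y 2 * w 2 j = LM a b 1 j) : False := by
  have hV : (Matrix.of ![x, y, fun _ => 1] : Matrix (Fin 3) (Fin 3) ℝ) * Matrix.of w = LM a b := by
    ext i j
    fin_cases i
    · simpa [Matrix.mul_apply, Fin.sum_univ_three] using hx j
    · simpa [Matrix.mul_apply, Fin.sum_univ_three] using hy j
    · have : LM a b 2 j = 1 := by fin_cases j <;> simp [LM]
      simp [Matrix.mul_apply, Fin.sum_univ_three, this, h1 j]
  have hdet : (Matrix.of ![x, y, fun _ => 1] : Matrix (Fin 3) (Fin 3) ℝ).det ≠ 0 := by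
    intro h0
    have := congrArg Matrix.det (LM_RM hab.1 hab.2.2.1)
    rw [← hV, Matrix.mul_assoc, Matrix.det_mul, h0] at this
    simp at this
  rw [Matrix.det_fin_three] at hdet
  simp at hdet
  rcases lt_trichotomy ((x 0 * y 1 - x 1 * y 0) + (x 1 * y 2 - x 2 * y 1)
    + (x 2 * y 0 - x 0 * y 2)) 0 with h | h | h
  · exact noPos hab (s 1) (s 0) (s 2) (hw 1) (hw 0) (hw 2) (fun j => by linarith [h1 j])
      (fun j => by linarith [hx j]) (fun j => by linarith [hy j]) (by linarith)
  · apply hdet; linarith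
  · exact noPos hab (s 0) (s 1) (s 2) (hw 0) (hw 1) (hw 2) h1 hx hy h

theorem forwardDir {a b : ℝ} (hab : 0 < a ∧ a < 1 ∧ 0 < b ∧ b < 1 ∧ 1 < a * b + a + b)
    (A : Matrix (Fin 4) (Fin 3) ℝ) (B : Matrix (Fin 3) (Fin 4) ℝ)
    (hA : ∀ i k, 0 ≤ A i k) (hB : ∀ k j, 0 ≤ B k j)
    (h : (!![1-a,1+a,1+a,1-a; 1-b,1-b,1+b,1+b; 1+a,1-a,1-a,1+a; 1+b,1+b,1-b,1-b] :
          Matrix (Fin 4) (Fin 4) ℝ) = A * B) : False := by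
  have hh : ∀ i j, (!![1-a,1+a,1+a,1-a; 1-b,1-b,1+b,1+b; 1+a,1-a,1-a,1+a; 1+b,1+b,1-b,1-b] :
          Matrix (Fin 4) (Fin 4) ℝ) i j = A i 0 * B 0 j + A i 1 * B 1 j + A i 2 * B 2 j := by
    intro i j
    rw [h, Matrix.mul_apply, Fin.sum_univ_three]
  clear h
  have h0 := hh 0
  have h1 := hh 1
  have h2 := hh 2
  have h3 := hh 3
  clear hh
  set V : Matrix (Fin 3) (Fin 3) ℝ := Matrix.of ![fun k => (A 2 k - A 0 k) / 2,
    fun k => (A 3 k - A 1 k) / 2, fun k => (A 0 k + A 2 k) / 2] with hVdef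
  have hV : V * B = LM a b := by
    ext i j
    have q0 := h0 j
    have q1 := h1 j
    have q2 := h2 j
    have q3 := h3 j
    clear h0 h1 h2 h3
    fin_cases i <;> fin_cases j <;>
      simp [Matrix.mul_apply, Fin.sum_univ_three, V, LM] at * <;> linarith
  have hW : V * (B * RM a b) = 1 := by
    rw [← Matrix.mul_assoc, hV, LM_RM hab.1 hab.2.2.1]
  have hW' : (B * RM a b) * V = 1 := mul_eq_one_comm.1 hW
  set d : Fin 3 → ℝ := fun k => A 0 k + A 2 k - A 1 k - A 3 k with hd
  have hdB : Matrix.vecMul d B = 0 := by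
    ext j
    have q0 := h0 j
    have q1 := h1 j
    have q2 := h2 j
    have q3 := h3 j
    clear h0 h1 h2 h3
    fin_cases j <;>
      simp [Matrix.vecMul, dotProduct, Fin.sum_univ_three, d] at * <;> linarith
  have hd0 : d = 0 := by
    have : Matrix.vecMul d ((B * RM a b) * V) = 0 := by
      rw [← Matrix.vecMul_vecMul, ← Matrix.vecMul_vecMul, hdB]; simp
    rwa [hW', Matrix.vecMul_one] at this
  have hdk : ∀ k, A 0 k + A 2 k - A 1 k - A 3 k = 0 := fun k => congrFun hd0 k
  have hc : ∀ k, 0 < (A 0 k + A 2 k) / 2 := by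
    intro k
    by_contra! hle
    have z0 := hA 0 k
    have z1 := hA 1 k
    have z2 := hA 2 k
    have z3 := hA 3 k
    have z4 := hdk k
    have hcol : ∀ i, V i k = 0 := by
      intro i
      fin_cases i <;> simp [V] <;> linarith
    have := congrFun (congrFun hW' k) k
    rw [Matrix.mul_apply] at this
    simp [hcol] at this
  have hV' : ∀ i j, V i 0 * B 0 j + V i 1 * B 1 j + V i 2 * B 2 j = LM a b i j := by
    intro i j
    rw [← hV, Matrix.mul_apply, Fin.sum_univ_three]
  apply noN (a := a) (b := b) (x := fun k => ((A 2 k - A 0 k) / 2) / ((A 0 k + A 2 k) / 2))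
    (y := fun k => ((A 3 k - A 1 k) / 2) / ((A 0 k + A 2 k) / 2))
    (w := fun k j => ((A 0 k + A 2 k) / 2) * B k j) hab
  · intro k
    have z0 := hA 0 k
    have z1 := hA 1 k
    have z2 := hA 2 k
    have z3 := hA 3 k
    have z4 := hdk k
    have z5 := hc k
    refine ⟨?_, ?_, ?_, ?_⟩
    · rw [le_div_iff₀ z5]; linarith
    · rw [div_le_iff₀ z5]; linarith
    · rw [le_div_iff₀ z5]; linarith
    · rw [div_le_iff₀ z5]; linarith
  · intro k j
    exact mul_nonneg (hc k).le (hB k j)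
  · intro j
    have := hV' 2 j
    have e : LM a b 2 j = 1 := by fin_cases j <;> simp [LM]
    rw [e] at this
    simpa [V] using this
  · intro j
    have := hV' 0 j
    simp only [← mul_assoc, div_mul_cancel₀ _ (hc _).ne']
    simpa [V] using this
  · intro j
    have := hV' 1 j
    simp only [← mul_assoc, div_mul_cancel₀ _ (hc _).ne']
    simpa [V] using this

theorem stmt_2 (a b : ℝ) (ha0 : 0 ≤ a) (ha1 : a < 1) (hb0 : 0 ≤ b) (hb1 : b < 1) :
    (∃ (A : Matrix (Fin 4) (Fin 3) ℝ) (B : Matrix (Fin 3) (Fin 4) ℝ),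
        (∀ i k, 0 ≤ A i k) ∧ (∀ k j, 0 ≤ B k j) ∧
        (!![1-a,1+a,1+a,1-a; 1-b,1-b,1+b,1+b; 1+a,1-a,1-a,1+a; 1+b,1+b,1-b,1-b] :
          Matrix (Fin 4) (Fin 4) ℝ) = A * B)
      ↔ a * b + a + b ≤ 1 := by
  constructor
  · rintro ⟨A, B, hA, hB, h⟩
    by_contra! hcon
    have hap : 0 < a := by
      rcases ha0.lt_or_eq with h | h
      · exact h
      · subst h; linarith
    have hbp : 0 < b := by
      rcases hb0.lt_or_eq with h | h
      · exact h
      · subst h; linarith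
    exact forwardDir ⟨hap, ha1, hbp, hb1, hcon⟩ A B hA hB h
  · intro h
    have hab := mul_nonneg ha0 hb0
    have p1 : 0 < 1 + a := by linarith
    have p2 : 0 < 1 + a ^ 2 := by positivity
    let X : Fin 4 → ℝ := ![1+a, 1-a, 1-a, 1+a]
    let Y : Fin 4 → ℝ := ![1+b, 1+b, 1-b, 1-b]
    have hX : ∀ j, 1 - a ≤ X j ∧ X j ≤ 1 + a := by
      intro j; fin_cases j <;> simp [X] <;> linarith
    have hY : ∀ j, 1 - b ≤ Y j ∧ Y j ≤ 1 + b := by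
      intro j; fin_cases j <;> simp [Y] <;> linarith
    refine ⟨!![0, 1 + a^2, 2; 2*(1+a^2), 0, 2; 2*(1+a)^2, 1-a^2, 0; 4*a, 2, 0],
      Matrix.of ![fun j => (2 * X j - (1-a^2) * Y j) / (4*(1+a)*(1+a^2)),
        fun j => (Y j * (1+a)^2 - 2*a*X j) / (2*(1+a)*(1+a^2)),
        fun j => (4*(1+a) - 2 * X j - (1+a)^2 * Y j) / (4*(1+a))], ?_, ?_, ?_⟩
    · intro i k
      fin_cases i <;> fin_cases k <;> simp <;> first | positivity | (rw [abs_of_nonneg ha0]; linarith)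
    · intro k j
      obtain ⟨u1, u2⟩ := hX j
      obtain ⟨v1, v2⟩ := hY j
      have t : 0 ≤ 2 - (1 + a) * (1 + b) := by linarith
      fin_cases k
      · show 0 ≤ (2 * X j - (1-a^2) * Y j) / (4*(1+a)*(1+a^2))
        apply div_nonneg _ (by positivity)
        have e1 : (1 - a^2) * Y j ≤ (1 - a^2) * (1 + b) :=
          mul_le_mul_of_nonneg_left v2 (by nlinarith)
        nlinarith [mul_nonneg (sub_nonneg.2 ha1.le) t]
      · show 0 ≤ (Y j * (1+a)^2 - 2*a*X j) / (2*(1+a)*(1+a^2))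
        apply div_nonneg _ (by positivity)
        have e1 := mul_le_mul_of_nonneg_right v1 (sq_nonneg (1 + a))
        have e2 := mul_le_mul_of_nonneg_left u2 ha0
        nlinarith [mul_nonneg p1.le t]
      · show 0 ≤ (4*(1+a) - 2 * X j - (1+a)^2 * Y j) / (4*(1+a))
        apply div_nonneg _ (by positivity)
        have e1 := mul_le_mul_of_nonneg_left v2 (sq_nonneg (1 + a))
        nlinarith [mul_nonneg p1.le t]
    · ext i j
      fin_cases i <;> fin_cases j <;>
        simp [Matrix.mul_apply, Fin.sum_univ_three, X, Y] <;> field_simp <;> ring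
end

section
/- If a nonnegative m×n rational matrix P has nonnegative rank at most 3, then there exist a nonnegative m×3 matrix A and a nonnegative 3×n matrix B, both with all entries rational, such that P = A·B. -/
open Filter Topology

def NR3Good {m n : ℕ} (P : Fin m → Fin n → ℚ) : Prop :=
  ∃ (a1 a2 a3 : Fin m → ℚ) (b1 b2 b3 : Fin n → ℚ),
    (∀ i, 0 ≤ a1 i) ∧ (∀ i, 0 ≤ a2 i) ∧ (∀ i, 0 ≤ a3 i) ∧
    (∀ j, 0 ≤ b1 j) ∧ (∀ j, 0 ≤ b2 j) ∧ (∀ j, 0 ≤ b3 j) ∧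
    ∀ i j, P i j = a1 i * b1 j + a2 i * b2 j + a3 i * b3 j

structure NR3Fac {m n : ℕ} (P : Fin m → Fin n → ℚ) (a1 a2 a3 : Fin m → ℝ)
    (b1 b2 b3 : Fin n → ℝ) : Prop where
  ha1 : ∀ i, 0 ≤ a1 i
  ha2 : ∀ i, 0 ≤ a2 i
  ha3 : ∀ i, 0 ≤ a3 i
  hb1 : ∀ j, 0 ≤ b1 j
  hb2 : ∀ j, 0 ≤ b2 j
  hb3 : ∀ j, 0 ≤ b3 j
  eq : ∀ i j, (P i j : ℝ) = a1 i * b1 j + a2 i * b2 j + a3 i * b3 j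

section
variable {m n : ℕ} {P : Fin m → Fin n → ℚ} {a1 a2 a3 : Fin m → ℝ} {b1 b2 b3 : Fin n → ℝ}

theorem NR3Fac.swap12 (h : NR3Fac P a1 a2 a3 b1 b2 b3) : NR3Fac P a2 a1 a3 b2 b1 b3 :=
  ⟨h.ha2, h.ha1, h.ha3, h.hb2, h.hb1, h.hb3, fun i j => by rw [h.eq]; ring⟩

theorem NR3Fac.rot (h : NR3Fac P a1 a2 a3 b1 b2 b3) : NR3Fac P a2 a3 a1 b2 b3 b1 :=
  ⟨h.ha2, h.ha3, h.ha1, h.hb2, h.hb3, h.hb1, fun i j => by rw [h.eq]; ring⟩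

theorem NR3Fac.tr (h : NR3Fac P a1 a2 a3 b1 b2 b3) :
    NR3Fac (fun j i => P i j) b1 b2 b3 a1 a2 a3 :=
  ⟨h.hb1, h.hb2, h.hb3, h.ha1, h.ha2, h.ha3, fun i j => by rw [h.eq]; ring⟩

theorem NR3Good.tr (h : NR3Good P) : NR3Good (fun j i => P i j) := by
  obtain ⟨a1, a2, a3, b1, b2, b3, h1, h2, h3, h4, h5, h6, h⟩ := h
  exact ⟨b1, b2, b3, a1, a2, a3, h4, h5, h6, h1, h2, h3, fun i j => (h j i).trans (by ring)⟩

theorem nr3_phi : ∃ φ : ℕ → (ℝ →ₗ[ℚ] ℚ),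
    ∀ s : ℝ, Tendsto (fun k => ((φ k s : ℚ) : ℝ)) atTop (𝓝 s) := by
  let β := Module.Basis.ofVectorSpace ℚ ℝ
  have hr : ∀ k : ℕ, ∀ l, ∃ q : ℚ, |(q : ℝ) - β l| < 1 / ((k : ℝ) + 1) := by
    intro k l
    have hpos : (0 : ℝ) < 1 / ((k : ℝ) + 1) := by positivity
    obtain ⟨q, h1, h2⟩ := exists_rat_btwn
      (show β l - 1 / ((k : ℝ) + 1) < β l + 1 / ((k : ℝ) + 1) by linarith)
    exact ⟨q, by rw [abs_lt]; constructor <;> linarith⟩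
  choose r hr using hr
  refine ⟨fun k => β.constr ℚ (r k), fun s => ?_⟩
  have hlim : ∀ l, Tendsto (fun k => (r k l : ℝ)) atTop (𝓝 (β l)) := by
    intro l
    rw [tendsto_iff_dist_tendsto_zero]
    refine squeeze_zero (fun _ => dist_nonneg) (fun k => ?_) tendsto_one_div_add_atTop_nhds_zero_nat
    rw [Real.dist_eq]; exact (hr k l).le
  have hs : s = ∑ l ∈ (β.repr s).support, ((β.repr s l : ℚ) : ℝ) * β l := by
    conv_lhs => rw [← β.linearCombination_repr s]
    rw [Finsupp.linearCombination_apply, Finsupp.sum]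
    simp only [Rat.smul_def]
  have hk : ∀ k, (((β.constr ℚ (r k)) s : ℚ) : ℝ)
      = ∑ l ∈ (β.repr s).support, ((β.repr s l : ℚ) : ℝ) * (r k l : ℝ) := by
    intro k
    rw [Module.Basis.constr_apply, Finsupp.sum]
    push_cast
    simp
  simp only [hk]
  conv => rhs; rw [hs]
  exact tendsto_finsetSum _ fun l _ => (hlim l).const_mul _

/-- rational cone lemma -/
theorem nr3_cone (g1 g2 g3 v : Fin m → ℚ) (c1 c2 c3 : ℝ) (h1 : 0 ≤ c1) (h2 : 0 ≤ c2) (h3 : 0 ≤ c3)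
    (h : ∀ i, (v i : ℝ) = g1 i * c1 + g2 i * c2 + g3 i * c3) :
    ∃ d1 d2 d3 : ℚ, 0 ≤ d1 ∧ 0 ≤ d2 ∧ 0 ≤ d3 ∧
      ∀ i, v i = g1 i * d1 + g2 i * d2 + g3 i * d3 := by
  obtain ⟨φ, hφ⟩ := nr3_phi
  have pos : ∀ c : ℝ, 0 ≤ c → ∀ᶠ k in atTop, 0 ≤ φ k c := by
    intro c hc
    rcases hc.eq_or_lt with h | h
    · subst h; simp
    · filter_upwards [(hφ c).eventually_const_lt h] with k hk
      exact_mod_cast hk.le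
  have hone := (hφ 1).eventually_const_lt one_pos
  obtain ⟨k, k1, k2, k3, k0⟩ := ((pos _ h1).and ((pos _ h2).and ((pos _ h3).and hone))).exists
  have k0' : 0 < φ k 1 := by exact_mod_cast k0
  refine ⟨φ k c1 / φ k 1, φ k c2 / φ k 1, φ k c3 / φ k 1, by positivity, by positivity,
    by positivity, fun i => ?_⟩
  have := congrArg (φ k) (h i)
  have e : ∀ (q : ℚ) (x : ℝ), φ k (q * x) = q * φ k x := by
    intro q x
    rw [← Rat.smul_def, map_smul, smul_eq_mul]
  have e0 : φ k (v i) = v i * φ k 1 := by rw [← e, mul_one]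
  rw [map_add, map_add, e, e, e, e0] at this
  field_simp
  linarith

theorem nr3_rat (r1 r2 r3 : Fin m → ℚ)
    (h : NR3Fac P (fun i => (r1 i : ℝ)) (fun i => (r2 i : ℝ)) (fun i => (r3 i : ℝ)) b1 b2 b3) :
    NR3Good P := by
  have := fun j => nr3_cone r1 r2 r3 (fun i => P i j) (b1 j) (b2 j) (b3 j) (h.hb1 j) (h.hb2 j)
    (h.hb3 j) (fun i => h.eq i j)
  choose d1 d2 d3 h1 h2 h3 hd using this
  exact ⟨r1, r2, r3, d1, d2, d3, fun i => by exact_mod_cast h.ha1 i,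
    fun i => by exact_mod_cast h.ha2 i, fun i => by exact_mod_cast h.ha3 i, h1, h2, h3,
    fun i j => hd j i⟩

theorem nr3_wedge [Nonempty (Fin n)] (p q : Fin n → ℝ) (hp : ∀ j, 0 ≤ p j) (hq : ∀ j, 0 ≤ q j) :
    ∃ ja jb : Fin n, ∀ j, ∃ l μ : ℝ, 0 ≤ l ∧ 0 ≤ μ ∧ p j = l * p ja + μ * p jb ∧
      q j = l * q ja + μ * q jb := by
  classical
  let S := Finset.univ.filter (fun j => 0 < p j + q j)
  by_cases hS : S.Nonempty
  · obtain ⟨ja, hja, hamax⟩ := S.exists_max_image (fun j => p j / (p j + q j)) hS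
    obtain ⟨jb, hjb, hbmin⟩ := S.exists_min_image (fun j => p j / (p j + q j)) hS
    have ha : 0 < p ja + q ja := by simpa [S] using hja
    have hb : 0 < p jb + q jb := by simpa [S] using hjb
    refine ⟨ja, jb, fun j => ?_⟩
    by_cases hj : 0 < p j + q j
    · have hjS : j ∈ S := by simp [S, hj]
      have h1 := hamax j hjS
      have h2 := hbmin j hjS
      rw [div_le_div_iff₀ (by assumption) (by assumption)] at h1 h2
      by_cases hD : 0 < p ja * q jb - p jb * q ja
      · refine ⟨(p j * q jb - p jb * q j) / (p ja * q jb - p jb * q ja),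
          (p ja * q j - p j * q ja) / (p ja * q jb - p jb * q ja),
          div_nonneg (by linarith) hD.le, div_nonneg (by linarith) hD.le, ?_, ?_⟩ <;>
        · have hD' := hD.ne'
          rw [div_mul_eq_mul_div, div_mul_eq_mul_div, ← add_div, eq_div_iff hD']
          ring
      · -- all proportional
        have h3 := hamax jb hjb
        rw [div_le_div_iff₀ (by assumption) (by assumption)] at h3
        have hD' : p ja * q jb = p jb * q ja := by linarith
        have key : p j / (p j + q j) = p ja / (p ja + q ja) := by
          apply le_antisymm (hamax j hjS)
          have : p ja / (p ja + q ja) = p jb / (p jb + q jb) := by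
            rw [div_eq_div_iff ha.ne' hb.ne']; linarith
          rw [this]; exact hbmin j hjS
        rw [div_eq_div_iff hj.ne' ha.ne'] at key
        refine ⟨(p j + q j) / (p ja + q ja), 0, by positivity, le_rfl, ?_, ?_⟩ <;>
        · field_simp
          linarith
    · have h1 := hp j
      have h2 := hq j
      exact ⟨0, 0, le_rfl, le_rfl, by linarith, by linarith⟩
  · obtain ⟨j0⟩ := ‹Nonempty (Fin n)›
    refine ⟨j0, j0, fun j => ⟨0, 0, le_rfl, le_rfl, ?_, ?_⟩⟩ <;>
    · have : ¬ 0 < p j + q j := fun h => hS ⟨j, by simp [S, h]⟩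
      have h1 := hp j
      have h2 := hq j
      linarith

theorem nr3_push (r v : Fin m → ℚ) (c : ℝ) (hr : ∀ i, 0 ≤ r i)
    (h : ∀ i, (r i : ℝ) * c ≤ v i) : ∃ s : ℚ, c ≤ s ∧ ∀ i, 0 ≤ v i - s * r i := by
  classical
  let S := Finset.univ.filter (fun i => 0 < r i)
  have hz : ∀ i, i ∉ S → r i = 0 := fun i hi =>
    le_antisymm (not_lt.1 fun h => hi (by simp [S, h])) (hr i)
  have hv : ∀ i, r i = 0 → 0 ≤ v i := by
    intro i hi
    have := h i
    rw [hi] at this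
    simp at this
    exact_mod_cast this
  by_cases hS : S.Nonempty
  · obtain ⟨i0, hi0, hmin⟩ := S.exists_min_image (fun i => v i / r i) hS
    have h0 : 0 < r i0 := by simpa [S] using hi0
    refine ⟨v i0 / r i0, ?_, fun i => ?_⟩
    · have h0' : (0 : ℝ) < r i0 := by exact_mod_cast h0
      push_cast
      rw [le_div_iff₀ h0']
      linarith [h i0]
    · by_cases hi : i ∈ S
      · have hri : 0 < r i := by simpa [S] using hi
        have := hmin i hi
        rw [le_div_iff₀ hri] at this
        linarith
      · rw [hz i hi]; simpa using hv i (hz i hi)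
  · obtain ⟨s, hs⟩ := exists_rat_gt c
    refine ⟨s, hs.le, fun i => ?_⟩
    have := hz i (fun hi => hS ⟨i, hi⟩)
    rw [this]; simpa using hv i this

theorem nr3_R (r : Fin m → ℚ) (h : NR3Fac P (fun i => (r i : ℝ)) a2 a3 b1 b2 b3) :
    NR3Good P := by
  rcases isEmpty_or_nonempty (Fin n) with hn | hn
  · exact ⟨0, 0, 0, 0, 0, 0, by simp, by simp, by simp, by simp, by simp, by simp,
      fun i j => hn.elim j⟩
  obtain ⟨ja, jb, hw⟩ := nr3_wedge b2 b3 h.hb2 h.hb3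
  have hr : ∀ i, 0 ≤ r i := fun i => by exact_mod_cast h.ha1 i
  have hp : ∀ j, ∃ s : ℚ, b1 j ≤ s ∧ ∀ i, 0 ≤ P i j - s * r i := by
    intro j
    refine nr3_push r (fun i => P i j) (b1 j) hr (fun i => ?_)
    have := h.eq i j
    have := mul_nonneg (h.ha2 i) (h.hb2 j)
    have := mul_nonneg (h.ha3 i) (h.hb3 j)
    linarith
  obtain ⟨s, hs, hs'⟩ := hp ja
  obtain ⟨t, ht, ht'⟩ := hp jb
  choose l μ hl hμ e1 e2 using hw
  refine nr3_rat r (fun i => P i ja - s * r i) (fun i => P i jb - t * r i)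
    (b1 := fun j => b1 j + l j * (s - b1 ja) + μ j * (t - b1 jb)) (b2 := l) (b3 := μ)
    ⟨h.ha1, fun i => by exact_mod_cast hs' i, fun i => by exact_mod_cast ht' i, fun j => ?_,
      hl, hμ, fun i j => ?_⟩
  · have := mul_nonneg (hl j) (sub_nonneg.2 hs)
    have := mul_nonneg (hμ j) (sub_nonneg.2 ht)
    have := h.hb1 j
    linarith
  · push_cast
    rw [h.eq i j, h.eq i ja, h.eq i jb, e1, e2]
    ring

theorem nr3_R' (h : NR3Fac P a1 a2 a3 b1 b2 b3) (r : Fin m → ℚ) (κ : ℝ) (hκ : 0 < κ)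
    (hr : ∀ i, (r i : ℝ) = κ * a1 i) : NR3Good P := by
  refine nr3_R r (a2 := a2) (a3 := a3) (b1 := fun j => b1 j / κ) (b2 := b2) (b3 := b3)
    ⟨fun i => ?_, h.ha2, h.ha3, fun j => div_nonneg (h.hb1 j) hκ.le, h.hb2, h.hb3, fun i j => ?_⟩
  · rw [hr]; exact mul_nonneg hκ.le (h.ha1 i)
  · rw [hr, h.eq]; field_simp

theorem nr3_depa (h : NR3Fac P a1 a2 a3 b1 b2 b3) (l μ : ℝ) (hl : 0 ≤ l) (hμ : 0 ≤ μ)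
    (he : ∀ i, a1 i = l * a2 i + μ * a3 i) : NR3Good P := by
  refine nr3_R 0 (a2 := a2) (a3 := a3) (b1 := 0) (b2 := fun j => b2 j + l * b1 j)
    (b3 := fun j => b3 j + μ * b1 j) ⟨by simp, h.ha2, h.ha3, by simp,
    fun j => add_nonneg (h.hb2 j) (mul_nonneg hl (h.hb1 j)),
    fun j => add_nonneg (h.hb3 j) (mul_nonneg hμ (h.hb1 j)), fun i j => ?_⟩
  rw [h.eq, he]; simp; ring

theorem nr3_depb (h : NR3Fac P a1 a2 a3 b1 b2 b3) (c1 c2 c3 : ℝ) (h1 : 0 < c1)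
    (he : ∀ i, c1 * a1 i + c2 * a2 i + c3 * a3 i = 0) : NR3Good P := by
  rcases le_or_gt c2 0 with h2 | h2
  · rcases le_or_gt c3 0 with h3 | h3
    · refine nr3_depa h (-c2 / c1) (-c3 / c1) (div_nonneg (by linarith) h1.le)
        (div_nonneg (by linarith) h1.le) (fun i => ?_)
      have := he i
      field_simp
      linarith
    · -- c1, c3 > 0, c2 ≤ 0
      rcases h2.eq_or_lt with h2' | h2'
      · subst h2'
        refine nr3_depa h 0 0 le_rfl le_rfl (fun i => ?_)
        have := he i
        nlinarith [h.ha1 i, mul_nonneg h1.le (h.ha1 i), mul_nonneg h3.le (h.ha3 i)]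
      · refine nr3_depa h.swap12 (-c1 / c2) (-c3 / c2) (div_nonneg_of_nonpos (by linarith) h2)
          (div_nonneg_of_nonpos (by linarith) h2) (fun i => ?_)
        have := he i
        have hc2 : c2 ≠ 0 := h2'.ne
        field_simp
        linarith
  · rcases le_or_gt 0 c3 with h3 | h3
    · refine nr3_depa h 0 0 le_rfl le_rfl (fun i => ?_)
      have := he i
      nlinarith [h.ha1 i, mul_nonneg h1.le (h.ha1 i), mul_nonneg h3 (h.ha3 i),
        mul_nonneg h2.le (h.ha2 i)]
    · refine nr3_depa h.rot.rot (-c1 / c3) (-c2 / c3) (div_nonneg_of_nonpos (by linarith) h3.le)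
          (div_nonneg_of_nonpos (by linarith) h3.le) (fun i => ?_)
      have := he i
      have hc3 : c3 ≠ 0 := h3.ne
      field_simp
      linarith

theorem nr3_depc (h : NR3Fac P a1 a2 a3 b1 b2 b3) (c1 c2 c3 : ℝ) (h1 : c1 ≠ 0)
    (he : ∀ i, c1 * a1 i + c2 * a2 i + c3 * a3 i = 0) : NR3Good P := by
  rcases lt_or_gt_of_ne h1 with h1 | h1
  · exact nr3_depb h (-c1) (-c2) (-c3) (by linarith) (fun i => by linarith [he i])
  · exact nr3_depb h c1 c2 c3 h1 he

/-- dual vectors when `b` is independent -/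
theorem nr3_dual (h : NR3Fac P a1 a2 a3 b1 b2 b3) (hG : ¬ NR3Good P) (y1 y2 y3 : ℝ) :
    ∃ c : Fin n → ℝ, ∑ j, b1 j * c j = y1 ∧ ∑ j, b2 j * c j = y2 ∧ ∑ j, b3 j * c j = y3 := by
  classical
  let L : (Fin n → ℝ) →ₗ[ℝ] (Fin 3 → ℝ) := Matrix.mulVecLin (Matrix.of ![b1, b2, b3])
  have htop : LinearMap.range L = ⊤ := by
    by_contra hne
    obtain ⟨f, hf, hle⟩ := Submodule.exists_le_ker_of_lt_top _ (lt_top_iff_ne_top.2 hne)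
    have hfv : ∀ v : Fin 3 → ℝ, f v = f (Pi.single 0 1) * v 0 + f (Pi.single 1 1) * v 1
        + f (Pi.single 2 1) * v 2 := by
      intro v
      have : v = v 0 • Pi.single 0 1 + v 1 • Pi.single 1 1 + v 2 • Pi.single 2 1 := by
        ext k; fin_cases k <;> simp
      conv_lhs => rw [this]
      simp only [map_add, map_smul, smul_eq_mul]
      ring
    have hj : ∀ j, f (Pi.single 0 1) * b1 j + f (Pi.single 1 1) * b2 j
        + f (Pi.single 2 1) * b3 j = 0 := by
      intro j
      have : f (L (Pi.single j 1)) = 0 := hle ⟨_, rfl⟩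
      rw [hfv] at this
      simpa [L] using this
    have hG' : ¬ NR3Good (fun j i => P i j) := fun g => hG g.tr
    have z0 : f (Pi.single 0 1) = 0 := by
      by_contra h0
      exact hG' (nr3_depc h.tr _ _ _ h0 hj)
    have z1 : f (Pi.single 1 1) = 0 := by
      by_contra h0
      exact hG' (nr3_depc h.tr.rot _ (f (Pi.single 2 1)) (f (Pi.single 0 1)) h0
        (fun j => by linarith [hj j]))
    have z2 : f (Pi.single 2 1) = 0 := by
      by_contra h0
      exact hG' (nr3_depc h.tr.rot.rot _ (f (Pi.single 0 1)) (f (Pi.single 1 1)) h0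
        (fun j => by linarith [hj j]))
    apply hf
    refine LinearMap.ext fun v => ?_
    rw [hfv, z0, z1, z2]; simp
  obtain ⟨c, hc⟩ := LinearMap.range_eq_top.1 htop ![y1, y2, y3]
  refine ⟨c, ?_, ?_, ?_⟩
  · simpa [L, Matrix.mulVec, dotProduct] using congrFun hc 0
  · simpa [L, Matrix.mulVec, dotProduct] using congrFun hc 1
  · simpa [L, Matrix.mulVec, dotProduct] using congrFun hc 2

/-- `P` applied to a vector -/
theorem NR3Fac.app (h : NR3Fac P a1 a2 a3 b1 b2 b3) (c : Fin n → ℝ) (i : Fin m) :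
    ∑ j, (P i j : ℝ) * c j
      = a1 i * ∑ j, b1 j * c j + a2 i * ∑ j, b2 j * c j + a3 i * ∑ j, b3 j * c j := by
  simp only [Finset.mul_sum, ← Finset.sum_add_distrib]
  exact Finset.sum_congr rfl fun j _ => by rw [h.eq]; ring

theorem nr3_phi_sum (φ : ℕ → (ℝ →ₗ[ℚ] ℚ))
    (hφ : ∀ s : ℝ, Tendsto (fun k => ((φ k s : ℚ) : ℝ)) atTop (𝓝 s)) (b c : Fin n → ℝ) :
    Tendsto (fun k => ∑ j, b j * ((φ k (c j) : ℚ) : ℝ)) atTop (𝓝 (∑ j, b j * c j)) :=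
  tendsto_finsetSum _ fun j _ => (hφ (c j)).const_mul _

/-- the first column has a nontrivial zero -/
theorem nr3_zero (h : NR3Fac P a1 a2 a3 b1 b2 b3) (hG : ¬ NR3Good P) :
    ∃ i, a1 i = 0 ∧ (a2 i ≠ 0 ∨ a3 i ≠ 0) := by
  by_contra hno
  push Not at hno
  -- choose δ
  have hδ : ∃ δ : ℝ, 0 < δ ∧ ∀ i, 0 < a1 i → 0 < a1 i + a2 i * (-δ) + a3 i * (-δ) := by
    have : ∀ᶠ δ in 𝓝[>] (0 : ℝ), ∀ i, 0 < a1 i → 0 < a1 i + a2 i * (-δ) + a3 i * (-δ) := by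
      rw [eventually_all]
      intro i
      by_cases hi : 0 < a1 i
      · have hc : Continuous fun δ : ℝ => a1 i + a2 i * (-δ) + a3 i * (-δ) := by fun_prop
        have := (hc.tendsto 0).eventually_const_lt (by simpa using hi)
        filter_upwards [nhdsWithin_le_nhds this] with δ hδ _
        exact hδ
      · exact Eventually.of_forall fun δ h => absurd h hi
    obtain ⟨δ, h1, h2⟩ := ((eventually_mem_nhdsWithin (a := (0 : ℝ)) (s := Set.Ioi 0)).and this).exists
    exact ⟨δ, h1, h2⟩
  obtain ⟨δ, hδ0, hδ⟩ := hδ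
  obtain ⟨c, hc1, hc2, hc3⟩ := nr3_dual h hG 1 (-δ) (-δ)
  obtain ⟨φ, hφ⟩ := nr3_phi
  have t1 := nr3_phi_sum φ hφ b1 c
  have t2 := nr3_phi_sum φ hφ b2 c
  have t3 := nr3_phi_sum φ hφ b3 c
  rw [hc1] at t1
  rw [hc2] at t2
  rw [hc3] at t3
  have tpos : ∀ᶠ k in atTop, ∀ i, 0 < a1 i → 0 < ∑ j, (P i j : ℝ) * ((φ k (c j) : ℚ) : ℝ) := by
    rw [eventually_all]
    intro i
    by_cases hi : 0 < a1 i
    · have := nr3_phi_sum φ hφ (fun j => (P i j : ℝ)) c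
      rw [h.app, hc1, hc2, hc3, mul_one] at this
      filter_upwards [this.eventually_const_lt (hδ i hi)] with k hk _
      exact hk
    · exact Eventually.of_forall fun δ h => absurd h hi
  obtain ⟨k, k1, k2, k3, kp⟩ := ((t1.eventually_const_lt one_pos).and
    ((t2.eventually_lt_const (neg_lt_zero.2 hδ0)).and
    ((t3.eventually_lt_const (neg_lt_zero.2 hδ0)).and tpos))).exists
  have hx := fun i => h.app (fun j => ((φ k (c j) : ℚ) : ℝ)) i
  set x1 := ∑ j, b1 j * ((φ k (c j) : ℚ) : ℝ)
  set x2 := ∑ j, b2 j * ((φ k (c j) : ℚ) : ℝ)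
  set x3 := ∑ j, b3 j * ((φ k (c j) : ℚ) : ℝ)
  apply hG
  refine nr3_R (fun i => ∑ j, P i j * φ k (c j)) (a2 := a2) (a3 := a3)
    (b1 := fun j => b1 j / x1) (b2 := fun j => b2 j + b1 j * (-x2 / x1))
    (b3 := fun j => b3 j + b1 j * (-x3 / x1))
    ⟨fun i => ?_, h.ha2, h.ha3, fun j => div_nonneg (h.hb1 j) k1.le,
    fun j => add_nonneg (h.hb2 j) (mul_nonneg (h.hb1 j) (div_nonneg (by linarith) k1.le)),
    fun j => add_nonneg (h.hb3 j) (mul_nonneg (h.hb1 j) (div_nonneg (by linarith) k1.le)),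
    fun i j => ?_⟩
  · push_cast
    rcases (h.ha1 i).eq_or_lt with h0 | h0
    · obtain ⟨e2, e3⟩ := hno i h0.symm
      rw [hx, ← h0, e2, e3]; simp
    · exact (kp i h0).le
  · push_cast
    rw [hx, h.eq]
    field_simp
    ring

/-- a row with exactly one nonzero entry -/
theorem nr3_single (h : NR3Fac P a1 a2 a3 b1 b2 b3) (hG : ¬ NR3Good P) (i : Fin m)
    (h1 : a1 i = 0) (h2 : a2 i = 0) : a3 i = 0 := by
  by_contra h3
  refine hG (NR3Good.tr (nr3_R' h.tr.rot.rot (fun j => P i j) (a3 i)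
    (lt_of_le_of_ne (h.ha3 i) (Ne.symm h3)) (fun j => ?_)))
  rw [h.eq, h1, h2]; ring

theorem nr3_tight (h : NR3Fac P a1 a2 a3 b1 b2 b3) (hG : ¬ NR3Good P) (i i' : Fin m)
    (h1 : a1 i = 0) (h1' : a1 i' = 0) : a2 i' * a3 i = a3 i' * a2 i := by
  by_contra hne
  obtain ⟨c, hc1, hc2, hc3⟩ := nr3_dual h hG 1 0 0
  obtain ⟨φ, hφ⟩ := nr3_phi
  have t1 := nr3_phi_sum φ hφ b1 c
  rw [hc1] at t1
  obtain ⟨k, k1⟩ := (t1.eventually_const_lt one_pos).exists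
  have hx := fun i => h.app (fun j => ((φ k (c j) : ℚ) : ℝ)) i
  have ha : ∀ i, φ k (a1 i) = ∑ j, P i j * φ k (c j) := by
    intro i
    have := h.app c i
    rw [hc1, hc2, hc3] at this
    have e : a1 i = ∑ j, (P i j : ℝ) * c j := by rw [this]; ring
    rw [e, map_sum]
    refine Finset.sum_congr rfl fun j _ => ?_
    rw [← Rat.smul_def, map_smul, smul_eq_mul]
  have ha' : ∀ i, ((φ k (a1 i) : ℚ) : ℝ) = ∑ j, (P i j : ℝ) * ((φ k (c j) : ℚ) : ℝ) := by
    intro i; rw [ha]; push_cast; rfl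
  simp only [← ha'] at hx
  set x1 := ∑ j, b1 j * ((φ k (c j) : ℚ) : ℝ)
  set x2 := ∑ j, b2 j * ((φ k (c j) : ℚ) : ℝ)
  set x3 := ∑ j, b3 j * ((φ k (c j) : ℚ) : ℝ)
  have e := hx i
  have e' := hx i'
  rw [h1, map_zero] at e
  rw [h1', map_zero] at e'
  simp at e e'
  have hD : a2 i' * a3 i - a3 i' * a2 i ≠ 0 := sub_ne_zero.2 hne
  have x20 : x2 = 0 := by
    have : (a2 i' * a3 i - a3 i' * a2 i) * x2 = 0 := by linear_combination a3 i' * e - a3 i * e'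
    exact (mul_eq_zero.1 this).resolve_left hD
  have x30 : x3 = 0 := by
    have : (a2 i' * a3 i - a3 i' * a2 i) * x3 = 0 := by linear_combination a2 i * e' - a2 i' * e
    exact (mul_eq_zero.1 this).resolve_left hD
  refine hG (nr3_R' h (fun i => φ k (a1 i)) x1 k1 (fun i => ?_))
  rw [hx, x20, x30]; ring

theorem nr3_K (h : NR3Fac P a1 a2 a3 b1 b2 b3) (hG : ¬ NR3Good P) :
    ∃ i, a1 i = 0 ∧ 0 < a2 i ∧ 0 < a3 i ∧ ∀ i', a1 i' = 0 → a2 i' * a3 i = a3 i' * a2 i := by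
  obtain ⟨i, h1, h23⟩ := nr3_zero h hG
  have e2 : a2 i ≠ 0 := by
    intro h2
    have := nr3_single h hG i h1 h2
    tauto
  have e3 : a3 i ≠ 0 := by
    intro h3
    exact e2 (nr3_single h.rot.rot hG i h3 h1)
  exact ⟨i, h1, lt_of_le_of_ne (h.ha2 i) e2.symm, lt_of_le_of_ne (h.ha3 i) e3.symm,
    fun i' hi' => nr3_tight h hG i i' h1 hi'⟩

theorem nr3_quad (A B C : ℚ) (r : ℝ) (h : (A : ℝ) * r ^ 2 + B * r + C = 0) (ε : ℝ) (hε : 0 < ε) :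
    ∃ q : ℚ, |(q : ℝ) - r| < ε ∧ 0 ≤ (A : ℝ) * q ^ 2 + B * q + C := by
  by_cases hr : ∃ q : ℚ, (q : ℝ) = r
  · obtain ⟨q, rfl⟩ := hr
    exact ⟨q, by simpa using hε, h.ge⟩
  have hf : ∀ q : ℝ, (A : ℝ) * q ^ 2 + B * q + C = (q - r) * (2 * A * r + B + A * (q - r)) := by
    intro q; linear_combination h
  have hA1 : (0 : ℝ) < |(A : ℝ)| + 1 := by positivity
  rcases lt_trichotomy (2 * (A : ℝ) * r + B) 0 with hd | hd | hd
  · obtain ⟨q, q1, q2⟩ := exists_rat_btwn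
      (show r - min ε (-(2 * (A : ℝ) * r + B) / (|(A : ℝ)| + 1)) < r by
        have : 0 < min ε (-(2 * (A : ℝ) * r + B) / (|(A : ℝ)| + 1)) :=
          lt_min hε (div_pos (by linarith) hA1)
        linarith)
    have m1 := min_le_left ε (-(2 * (A : ℝ) * r + B) / (|(A : ℝ)| + 1))
    have m2 := min_le_right ε (-(2 * (A : ℝ) * r + B) / (|(A : ℝ)| + 1))
    refine ⟨q, by rw [abs_lt]; constructor <;> linarith, ?_⟩
    rw [hf]
    have h2 : r - q < -(2 * (A : ℝ) * r + B) / (|(A : ℝ)| + 1) := by linarith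
    rw [lt_div_iff₀ hA1] at h2
    refine mul_nonneg_of_nonpos_of_nonpos (by linarith) ?_
    have h3 : 0 < r - q := by linarith
    nlinarith [neg_abs_le (A : ℝ), mul_nonneg h3.le (by linarith [neg_abs_le (A : ℝ)] : 0 ≤ |(A : ℝ)| + A)]
  · by_cases hA : A = 0
    · subst hA
      simp at hd
      subst hd
      obtain ⟨q, q1, q2⟩ := exists_rat_btwn (show r < r + ε by linarith)
      refine ⟨q, by rw [abs_lt]; constructor <;> linarith, ?_⟩
      simp at h ⊢
      exact h.ge
    · have hA' : (A : ℝ) ≠ 0 := by exact_mod_cast hA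
      refine absurd ⟨-B / (2 * A), ?_⟩ hr
      push_cast
      field_simp
      linarith
  · obtain ⟨q, q1, q2⟩ := exists_rat_btwn
      (show r < r + min ε ((2 * (A : ℝ) * r + B) / (|(A : ℝ)| + 1)) by
        have : 0 < min ε ((2 * (A : ℝ) * r + B) / (|(A : ℝ)| + 1)) :=
          lt_min hε (div_pos (by linarith) hA1)
        linarith)
    have m1 := min_le_left ε ((2 * (A : ℝ) * r + B) / (|(A : ℝ)| + 1))
    have m2 := min_le_right ε ((2 * (A : ℝ) * r + B) / (|(A : ℝ)| + 1))
    refine ⟨q, by rw [abs_lt]; constructor <;> linarith, ?_⟩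
    rw [hf]
    have h2 : q - r < (2 * (A : ℝ) * r + B) / (|(A : ℝ)| + 1) := by linarith
    rw [lt_div_iff₀ hA1] at h2
    refine mul_nonneg (by linarith) ?_
    have h3 : 0 < q - r := by linarith
    nlinarith [neg_abs_le (A : ℝ), mul_nonneg h3.le (by linarith [neg_abs_le (A : ℝ)] : 0 ≤ |(A : ℝ)| + A)]

def nr3det (x y z : ℝ × ℝ × ℝ) : ℝ :=
  x.1 * (y.2.1 * z.2.2 - y.2.2 * z.2.1) - x.2.1 * (y.1 * z.2.2 - y.2.2 * z.1)
    + x.2.2 * (y.1 * z.2.1 - y.2.1 * z.1)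

def nr3dot (x y : ℝ × ℝ × ℝ) : ℝ := x.1 * y.1 + x.2.1 * y.2.1 + x.2.2 * y.2.2

/-- a real change of basis gives another factorization -/
theorem nr3_change (h : NR3Fac P a1 a2 a3 b1 b2 b3) (x y z : ℝ × ℝ × ℝ) (hd : 0 < nr3det x y z)
    (h1 : ∀ i, 0 ≤ nr3dot (a1 i, a2 i, a3 i) x) (h2 : ∀ i, 0 ≤ nr3dot (a1 i, a2 i, a3 i) y)
    (h3 : ∀ i, 0 ≤ nr3dot (a1 i, a2 i, a3 i) z)
    (k1 : ∀ j, 0 ≤ nr3det (b1 j, b2 j, b3 j) y z) (k2 : ∀ j, 0 ≤ nr3det x (b1 j, b2 j, b3 j) z)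
    (k3 : ∀ j, 0 ≤ nr3det x y (b1 j, b2 j, b3 j)) :
    NR3Fac P (fun i => nr3dot (a1 i, a2 i, a3 i) x) (fun i => nr3dot (a1 i, a2 i, a3 i) y)
      (fun i => nr3dot (a1 i, a2 i, a3 i) z) (fun j => nr3det (b1 j, b2 j, b3 j) y z / nr3det x y z)
      (fun j => nr3det x (b1 j, b2 j, b3 j) z / nr3det x y z)
      (fun j => nr3det x y (b1 j, b2 j, b3 j) / nr3det x y z) := by
  refine ⟨h1, h2, h3, fun j => div_nonneg (k1 j) hd.le, fun j => div_nonneg (k2 j) hd.le,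
    fun j => div_nonneg (k3 j) hd.le, fun i j => ?_⟩
  rw [h.eq]
  have hd' := hd.ne'
  field_simp
  simp only [nr3det, nr3dot]
  ring

theorem nr3_main (h : NR3Fac P a1 a2 a3 b1 b2 b3) : NR3Good P := by
  by_contra hG
  have hG' : ¬ NR3Good (fun j i => P i j) := fun g => hG g.tr
  obtain ⟨i1, p1, p2, p3, hp⟩ := nr3_K h hG
  obtain ⟨i2, q2, q3, q1, hq⟩ := nr3_K h.rot hG
  obtain ⟨i3, r3, r1, r2, hr⟩ := nr3_K h.rot.rot hG
  obtain ⟨jY, y1, y2, y3, hy⟩ := nr3_K h.tr hG'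
  obtain ⟨jZ, z2, z3, z1, hz⟩ := nr3_K h.tr.rot hG'
  obtain ⟨jX, x3, x1, x2, hx⟩ := nr3_K h.tr.rot.rot hG'
  -- the determinant of the three columns
  have hD : 0 < b1 jX * b2 jY * b3 jZ + b2 jX * b3 jY * b1 jZ := by positivity
  set D := b1 jX * b2 jY * b3 jZ + b2 jX * b3 jY * b1 jZ with hDdef
  -- generic evaluations of the curves
  let X : ℝ × ℝ × ℝ := (b1 jX, b2 jX, 0)
  let Y : ℝ × ℝ × ℝ := (0, b2 jY, b3 jY)
  let Z : ℝ × ℝ × ℝ := (b1 jZ, 0, b3 jZ)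
  let u1 : ℝ × ℝ × ℝ := (0, a2 i1, a3 i1)
  let u2 : ℝ × ℝ × ℝ := (a1 i2, 0, a3 i2)
  let u3 : ℝ × ℝ × ℝ := (a1 i3, a2 i3, 0)
  let t1 : ℝ → ℝ × ℝ × ℝ := fun ρ =>
    (nr3dot u1 Z) • (ρ • X - Y) - (ρ * nr3dot u1 X - nr3dot u1 Y) • Z
  let t2 : ℝ → ℝ × ℝ × ℝ := fun ρ => nr3dot u2 (t1 ρ) • X - nr3dot u2 X • t1 ρ
  let t3 : ℝ → ℝ × ℝ × ℝ := fun ρ => nr3dot u3 (t2 ρ) • Y - nr3dot u3 Y • t2 ρ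
  let ρ0 : ℝ := b2 jY / b2 jX
  have e1 : t1 ρ0 = (a3 i1 * D / b2 jX, 0, 0) := by
    simp only [t1, ρ0, X, Y, Z, u1, nr3dot, hDdef]
    ext <;> simp only [Prod.fst_sub, Prod.snd_sub, Prod.smul_fst, Prod.smul_snd, smul_eq_mul] <;> field_simp <;> ring
  have τ1 : 0 < a3 i1 * D / b2 jX := by positivity
  set T1 := a3 i1 * D / b2 jX
  have e2 : t2 ρ0 = (0, T1 * a1 i2 * b2 jX, 0) := by
    simp only [t2, e1, X, u2, nr3dot]
    ext <;> simp only [Prod.fst_sub, Prod.snd_sub, Prod.smul_fst, Prod.smul_snd, smul_eq_mul] <;> ring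
  have τ2 : 0 < T1 * a1 i2 * b2 jX := by positivity
  set T2 := T1 * a1 i2 * b2 jX
  have e3 : t3 ρ0 = (0, 0, T2 * a2 i3 * b3 jY) := by
    simp only [t3, e2, Y, u3, nr3dot]
    ext <;> simp only [Prod.fst_sub, Prod.snd_sub, Prod.smul_fst, Prod.smul_snd, smul_eq_mul] <;> ring
  have τ3 : 0 < T2 * a2 i3 * b3 jY := by positivity
  set T3 := T2 * a2 i3 * b3 jY
  have ct1 : Continuous t1 := by simp only [t1]; fun_prop
  have ct2 : Continuous t2 := by simp only [t2, nr3dot]; fun_prop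
  have ct3 : Continuous t3 := by simp only [t3, nr3dot]; fun_prop
  have ev : ∀ f : ℝ → ℝ, Continuous f → ∀ s : ℝ, (0 < s → 0 < f ρ0) →
      ∀ᶠ ρ in 𝓝 ρ0, 0 < s → 0 < f ρ := by
    intro f hf s hs
    by_cases h0 : 0 < s
    · filter_upwards [(hf.tendsto ρ0).eventually_const_lt (hs h0)] with ρ hρ _
      exact hρ
    · exact Eventually.of_forall fun _ h => absurd h h0
  have E0 : ∀ᶠ ρ in 𝓝 ρ0, (0 : ℝ) < 1 → 0 < nr3det (t1 ρ) (t2 ρ) (t3 ρ) := by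
    refine ev _ (by simp only [nr3det]; fun_prop) 1 fun _ => ?_
    rw [e1, e2, e3]; simp only [nr3det]; ring_nf; positivity
  have EA1 : ∀ᶠ ρ in 𝓝 ρ0, ∀ i, 0 < a1 i → 0 < nr3dot (a1 i, a2 i, a3 i) (t1 ρ) := by
    rw [eventually_all]
    refine fun i => ev _ (by simp only [nr3dot]; fun_prop) _ fun hi => ?_
    rw [e1]; simp only [nr3dot]; ring_nf; positivity
  have EA2 : ∀ᶠ ρ in 𝓝 ρ0, ∀ i, 0 < a2 i → 0 < nr3dot (a1 i, a2 i, a3 i) (t2 ρ) := by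
    rw [eventually_all]
    refine fun i => ev _ (by simp only [nr3dot]; fun_prop) _ fun hi => ?_
    rw [e2]; simp only [nr3dot]; ring_nf; positivity
  have EA3 : ∀ᶠ ρ in 𝓝 ρ0, ∀ i, 0 < a3 i → 0 < nr3dot (a1 i, a2 i, a3 i) (t3 ρ) := by
    rw [eventually_all]
    refine fun i => ev _ (by simp only [nr3dot]; fun_prop) _ fun hi => ?_
    rw [e3]; simp only [nr3dot]; ring_nf; positivity
  have EB1 : ∀ᶠ ρ in 𝓝 ρ0, ∀ j, 0 < b1 j → 0 < nr3det (b1 j, b2 j, b3 j) (t2 ρ) (t3 ρ) := by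
    rw [eventually_all]
    refine fun i => ev _ (by simp only [nr3det]; fun_prop) _ fun hi => ?_
    rw [e2, e3]; simp only [nr3det]; ring_nf; positivity
  have EB2 : ∀ᶠ ρ in 𝓝 ρ0, ∀ j, 0 < b2 j → 0 < nr3det (t1 ρ) (b1 j, b2 j, b3 j) (t3 ρ) := by
    rw [eventually_all]
    refine fun i => ev _ (by simp only [nr3det]; fun_prop) _ fun hi => ?_
    rw [e1, e3]; simp only [nr3det]; ring_nf; positivity
  have EB3 : ∀ᶠ ρ in 𝓝 ρ0, ∀ j, 0 < b3 j → 0 < nr3det (t1 ρ) (t2 ρ) (b1 j, b2 j, b3 j) := by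
    rw [eventually_all]
    refine fun i => ev _ (by simp only [nr3det]; fun_prop) _ fun hi => ?_
    rw [e1, e2]; simp only [nr3det]; ring_nf; positivity
  obtain ⟨ε, hε, hball⟩ := Metric.eventually_nhds_iff.1
    (E0.and (EA1.and (EA2.and (EA3.and (EB1.and (EB2.and EB3))))))
  -- rational entries
  have P1X : (P i1 jX : ℝ) = nr3dot u1 X := by rw [h.eq]; simp [nr3dot, u1, X, p1, x3]
  have P1Y : (P i1 jY : ℝ) = nr3dot u1 Y := by rw [h.eq]; simp [nr3dot, u1, Y, p1]
  have P1Z : (P i1 jZ : ℝ) = nr3dot u1 Z := by rw [h.eq]; simp [nr3dot, u1, Z, p1, z2]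
  have P2X : (P i2 jX : ℝ) = nr3dot u2 X := by rw [h.eq]; simp [nr3dot, u2, X, q2, x3]
  have P2Y : (P i2 jY : ℝ) = nr3dot u2 Y := by rw [h.eq]; simp [nr3dot, u2, Y, q2, y1]
  have P2Z : (P i2 jZ : ℝ) = nr3dot u2 Z := by rw [h.eq]; simp [nr3dot, u2, Z, q2]
  have P3X : (P i3 jX : ℝ) = nr3dot u3 X := by rw [h.eq]; simp [nr3dot, u3, X, r3]
  have P3Y : (P i3 jY : ℝ) = nr3dot u3 Y := by rw [h.eq]; simp [nr3dot, u3, Y, r3, y1]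
  have P3Z : (P i3 jZ : ℝ) = nr3dot u3 Z := by rw [h.eq]; simp [nr3dot, u3, Z, r3, z2]
  let e : ℚ := P i1 jY * P i2 jZ - P i2 jY * P i1 jZ
  let A : ℚ := -(P i1 jZ * P i1 jX * (P i3 jZ * P i2 jX - P i3 jX * P i2 jZ))
  let B : ℚ := -(P i1 jZ * (P i3 jY * P i2 jZ * P i1 jX + P i3 jX * e
    - P i3 jZ * P i2 jX * P i1 jY))
  let C : ℚ := P i1 jZ * P i3 jY * e
  have hH : ∀ ρ : ℝ, nr3det (t1 ρ) Z (t3 ρ) = D * ((A : ℝ) * ρ ^ 2 + B * ρ + C) := by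
    intro ρ
    simp only [A, B, C, e]
    push_cast
    rw [P1X, P1Y, P1Z, P2X, P2Y, P2Z, P3X, P3Y, P3Z]
    simp only [t3, t2, t1, nr3det, nr3dot, X, Y, Z, u1, u2, u3, hDdef, Prod.fst_sub, Prod.snd_sub,
      Prod.smul_fst, Prod.smul_snd, smul_eq_mul]
    ring
  have hroot : (A : ℝ) * ρ0 ^ 2 + B * ρ0 + C = 0 := by
    have := hH ρ0
    rw [e1, e3] at this
    have h0 : D * ((A : ℝ) * ρ0 ^ 2 + B * ρ0 + C) = 0 := by
      rw [← this]; simp [nr3det, Z]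
    exact (mul_eq_zero.1 h0).resolve_left hD.ne'
  obtain ⟨ρ, hρ, hpos⟩ := nr3_quad A B C ρ0 hroot ε hε
  obtain ⟨f0, fa1, fa2, fa3, fb1, fb2, fb3⟩ := hball (y := (ρ : ℝ)) (by rwa [Real.dist_eq])
  have g : 0 ≤ nr3det (t1 ρ) Z (t3 ρ) := by rw [hH]; exact mul_nonneg hD.le hpos
  -- exact tightness
  have s1 : nr3dot u1 (t1 ρ) = 0 := by
    simp only [t1, nr3dot, Prod.fst_sub, Prod.snd_sub, Prod.smul_fst, Prod.smul_snd, smul_eq_mul]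
    ring
  have s2 : nr3dot u2 (t2 ρ) = 0 := by
    simp only [t2, nr3dot, Prod.fst_sub, Prod.snd_sub, Prod.smul_fst, Prod.smul_snd, smul_eq_mul]
    ring
  have s3 : nr3dot u3 (t3 ρ) = 0 := by
    simp only [t3, nr3dot, Prod.fst_sub, Prod.snd_sub, Prod.smul_fst, Prod.smul_snd, smul_eq_mul]
    ring
  have v3 : nr3det (t1 ρ) (t2 ρ) X = 0 := by
    simp only [t2, nr3det, Prod.fst_sub, Prod.snd_sub, Prod.smul_fst, Prod.smul_snd, smul_eq_mul]
    ring
  have v1 : nr3det Y (t2 ρ) (t3 ρ) = 0 := by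
    simp only [t3, nr3det, Prod.fst_sub, Prod.snd_sub, Prod.smul_fst, Prod.smul_snd, smul_eq_mul]
    ring
  have hrat : ∀ i, nr3dot (a1 i, a2 i, a3 i) (t1 ρ) =
      (((P i1 jZ * (ρ * P i jX - P i jY) - (ρ * P i1 jX - P i1 jY) * P i jZ : ℚ)) : ℝ) := by
    intro i
    push_cast
    rw [P1X, P1Y, P1Z, h.eq i jX, h.eq i jY, h.eq i jZ, x3, y1, z2]
    simp only [t1, nr3dot, X, Y, Z, u1, Prod.fst_sub, Prod.snd_sub,
      Prod.smul_fst, Prod.smul_snd, smul_eq_mul]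
    ring
  clear_value t1 t2 t3
  have F := nr3_change h (t1 ρ) (t2 ρ) (t3 ρ) (f0 one_pos)
    (fun i => ?_) (fun i => ?_) (fun i => ?_) (fun j => ?_) (fun j => ?_) (fun j => ?_)
  · simp only [hrat] at F
    exact hG (nr3_R _ F)
  · rcases (h.ha1 i).eq_or_lt with h0 | h0
    · have k := hp i h0.symm
      have : a3 i1 * nr3dot (a1 i, a2 i, a3 i) (t1 ρ) = 0 := by
        simp only [nr3dot, u1] at s1 ⊢
        rw [← h0]
        linear_combination (t1 ρ).2.1 * k + a3 i * s1
      exact ((mul_eq_zero.1 this).resolve_left p3.ne').ge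
    · exact (fa1 i h0).le
  · rcases (h.ha2 i).eq_or_lt with h0 | h0
    · have k := hq i h0.symm
      have : a1 i2 * nr3dot (a1 i, a2 i, a3 i) (t2 ρ) = 0 := by
        simp only [nr3dot, u2] at s2 ⊢
        rw [← h0]
        linear_combination (t2 ρ).2.2 * k + a1 i * s2
      exact ((mul_eq_zero.1 this).resolve_left q1.ne').ge
    · exact (fa2 i h0).le
  · rcases (h.ha3 i).eq_or_lt with h0 | h0
    · have k := hr i h0.symm
      have : a2 i3 * nr3dot (a1 i, a2 i, a3 i) (t3 ρ) = 0 := by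
        simp only [nr3dot, u3] at s3 ⊢
        rw [← h0]
        linear_combination (t3 ρ).1 * k + a2 i * s3
      exact ((mul_eq_zero.1 this).resolve_left r2.ne').ge
    · exact (fa3 i h0).le
  · rcases (h.hb1 j).eq_or_lt with h0 | h0
    · have k := hy j h0.symm
      have : b3 jY * nr3det (b1 j, b2 j, b3 j) (t2 ρ) (t3 ρ) = 0 := by
        simp only [nr3det, Y] at v1 ⊢
        rw [← h0]
        linear_combination b3 j * v1 -
          ((t2 ρ).1 * (t3 ρ).2.2 - (t2 ρ).2.2 * (t3 ρ).1) * k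
      exact ((mul_eq_zero.1 this).resolve_left y3.ne').ge
    · exact (fb1 j h0).le
  · rcases (h.hb2 j).eq_or_lt with h0 | h0
    · have k := hz j h0.symm
      have : b1 jZ * nr3det (t1 ρ) (b1 j, b2 j, b3 j) (t3 ρ) = b1 j * nr3det (t1 ρ) Z (t3 ρ) := by
        simp only [nr3det, Z]
        rw [← h0]
        linear_combination ((t1 ρ).2.1 * (t3 ρ).1 - (t1 ρ).1 * (t3 ρ).2.1) * k
      have h2 : 0 ≤ b1 jZ * nr3det (t1 ρ) (b1 j, b2 j, b3 j) (t3 ρ) := by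
        rw [this]; exact mul_nonneg (h.hb1 j) g
      exact nonneg_of_mul_nonneg_right h2 z1
    · exact (fb2 j h0).le
  · rcases (h.hb3 j).eq_or_lt with h0 | h0
    · have k := hx j h0.symm
      have : b2 jX * nr3det (t1 ρ) (t2 ρ) (b1 j, b2 j, b3 j) = 0 := by
        simp only [nr3det, X] at v3 ⊢
        rw [← h0]
        linear_combination b2 j * v3 +
          ((t1 ρ).2.1 * (t2 ρ).2.2 - (t1 ρ).2.2 * (t2 ρ).2.1) * k
      exact ((mul_eq_zero.1 this).resolve_left x2.ne').ge
    · exact (fb3 j h0).le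

end

theorem stmt_3 (m n : ℕ) (P : Matrix (Fin m) (Fin n) ℚ) (hP : ∀ i j, 0 ≤ P i j)
    (hfact : ∃ (A : Matrix (Fin m) (Fin 3) ℝ) (B : Matrix (Fin 3) (Fin n) ℝ),
        (∀ i k, 0 ≤ A i k) ∧ (∀ k j, 0 ≤ B k j) ∧ P.map (Rat.cast : ℚ → ℝ) = A * B) :
    ∃ (A : Matrix (Fin m) (Fin 3) ℚ) (B : Matrix (Fin 3) (Fin n) ℚ),
      (∀ i k, 0 ≤ A i k) ∧ (∀ k j, 0 ≤ B k j) ∧ P = A * B := by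
  obtain ⟨A, B, hA, hB, hAB⟩ := hfact
  have F : NR3Fac (fun i j => P i j) (fun i => A i 0) (fun i => A i 1) (fun i => A i 2)
      (fun j => B 0 j) (fun j => B 1 j) (fun j => B 2 j) := by
    refine ⟨fun i => hA _ _, fun i => hA _ _, fun i => hA _ _, fun i => hB _ _, fun i => hB _ _,
      fun i => hB _ _, fun i j => ?_⟩
    have := congrFun (congrFun hAB i) j
    simpa [Matrix.mul_apply, Fin.sum_univ_three] using this
  obtain ⟨a1, a2, a3, b1, b2, b3, h1, h2, h3, h4, h5, h6, h⟩ := nr3_main F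
  refine ⟨Matrix.of fun i => ![a1 i, a2 i, a3 i], Matrix.of ![b1, b2, b3], fun i k => ?_,
    fun k j => ?_, ?_⟩
  · fin_cases k
    · exact h1 i
    · exact h2 i
    · exact h3 i
  · fin_cases k
    · exact h4 j
    · exact h5 j
    · exact h6 j
  · ext i j
    simpa [Matrix.mul_apply, Fin.sum_univ_three] using h i j
end

section
/- A nonnegative m×n real matrix P has nonnegative rank at most 3 if and only if either rank(P) < 3, or rank(P) = 3 and there exists a triangle Δ with ℬ ⊆ Δ ⊆ 𝒜 such that either a vertex of Δ coincides with a vertex of 𝒜, or an edge of Δ contains an edge of ℬ. -/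
/-- `𝒜 = span(P) ∩ Δ_{m-1}`. -/
def spanSimplex {m n : ℕ} (P : Matrix (Fin m) (Fin n) ℝ) : Set (Fin m → ℝ) :=
  (Submodule.span ℝ (Set.range fun j => fun i => P i j) : Set (Fin m → ℝ)) ∩
    stdSimplex ℝ (Fin m)

/-- `ℬ = cone(P) ∩ Δ_{m-1}`. -/
def coneSimplex {m n : ℕ} (P : Matrix (Fin m) (Fin n) ℝ) : Set (Fin m → ℝ) :=
  {x | ∃ c : Fin n → ℝ, (∀ j, 0 ≤ c j) ∧ x = fun i => ∑ j, c j * P i j} ∩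
    stdSimplex ℝ (Fin m)

/-- The `j`-th vertex of `ℬ`: the `j`-th column of `P` normalized to sum 1. -/
noncomputable def vertexB {m n : ℕ} (P : Matrix (Fin m) (Fin n) ℝ) (j : Fin n) : Fin m → ℝ :=
  fun i => P i j / (∑ i', P i' j)

open Matrix Filter Topology

def NF {m n : ℕ} (Q : Matrix (Fin m) (Fin n) ℝ) (A : Matrix (Fin m) (Fin 3) ℝ)
    (B : Matrix (Fin 3) (Fin n) ℝ) : Prop :=
  (∀ i k, 0 ≤ A i k) ∧ (∀ k j, 0 ≤ B k j) ∧ Q = A * B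

def GoodA {m : ℕ} (A : Matrix (Fin m) (Fin 3) ℝ) : Prop :=
  ∃ k i i' l r, A i k = 0 ∧ A i' k = 0 ∧ A i l * A i' r ≠ A i r * A i' l

theorem NF.tr {m n : ℕ} {Q : Matrix (Fin m) (Fin n) ℝ} {A B} (h : NF Q A B) : NF Qᵀ Bᵀ Aᵀ :=
  ⟨fun i k => h.2.1 k i, fun k j => h.1 j k, by rw [h.2.2, Matrix.transpose_mul]⟩

theorem NF.li {m n : ℕ} {Q : Matrix (Fin m) (Fin n) ℝ} {A B} (h : NF Q A B) (hr : Q.rank = 3) :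
    LinearIndependent ℝ A.col := by
  have h1 : Q.rank ≤ A.rank := by rw [h.2.2]; exact Matrix.rank_mul_le_left A B
  have h2 : A.rank ≤ 3 := by simpa using A.rank_le_width
  rw [linearIndependent_iff_card_eq_finrank_span, Set.finrank, ← Matrix.rank_eq_finrank_span_cols]
  simp; omega

theorem NF.colpos {m n : ℕ} {Q : Matrix (Fin m) (Fin n) ℝ} {A B} (h : NF Q A B)
    (hr : Q.rank = 3) (k : Fin 3) : ∃ i, 0 < A i k := by
  by_contra! hc
  refine (h.li hr).ne_zero k ?_
  ext i
  exact le_antisymm (hc i) (h.1 i k)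

theorem expandA {m n : ℕ} {Q : Matrix (Fin m) (Fin n) ℝ} {A B} (h : NF Q A B)
    (hr : Q.rank = 3) {k l : Fin 3} (hkl : l ≠ k) :
    ∃ A' B', NF Q A' B' ∧ (∀ i r, r ≠ k → A' i r = A i r) ∧
      (∀ i, A i l = 0 → A' i k = A i k) ∧ ∃ i0, 0 < A i0 l ∧ A' i0 k = 0 := by
  classical
  obtain ⟨i1, hi1⟩ := h.colpos hr l
  obtain ⟨i0, hi0, hmin⟩ := Finset.exists_min_image (Finset.univ.filter fun i => 0 < A i l)
    (fun i => A i k / A i l) ⟨i1, by simpa using hi1⟩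
  simp only [Finset.mem_filter, Finset.mem_univ, true_and] at hi0 hmin
  set t := A i0 k / A i0 l with ht
  have ht0 : 0 ≤ t := div_nonneg (h.1 _ _) (h.1 _ _)
  have hk : ∀ i, (A * transvection l k (-t)) i k = A i k - t * A i l := by
    intro i; rw [mul_transvection_apply_same]; ring
  have hne : ∀ i r, r ≠ k → (A * transvection l k (-t)) i r = A i r := by
    intro i r hrk; rw [mul_transvection_apply_of_ne _ _ _ _ hrk]
  refine ⟨A * transvection l k (-t), transvection l k t * B, ⟨?_, ?_, ?_⟩, hne, ?_, i0, hi0, ?_⟩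
  · intro i r
    by_cases hrk : r = k
    · subst hrk
      rw [hk]
      rcases (h.1 i l).eq_or_lt with h0 | h0
      · rw [← h0]; simpa using h.1 i r
      · have := hmin i h0
        rw [le_div_iff₀ h0] at this
        linarith
    · rw [hne i r hrk]; exact h.1 _ _
  · intro r j
    by_cases hrl : r = l
    · subst hrl
      rw [transvection_mul_apply_same]
      have := h.2.1 r j; have := mul_nonneg ht0 (h.2.1 k j)
      linarith
    · rw [transvection_mul_apply_of_ne _ _ _ _ hrl]; exact h.2.1 _ _
  · rw [Matrix.mul_assoc, ← Matrix.mul_assoc (transvection l k (-t)),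
      transvection_mul_transvection_same _ _ hkl]
    simpa using h.2.2
  · intro i hi; rw [hk, hi]; ring
  · rw [hk, ht]; field_simp; ring

theorem twozero {m n : ℕ} {Q : Matrix (Fin m) (Fin n) ℝ} (hr : Q.rank = 3)
    (H : ∀ A B, NF Q A B → ¬ GoodA A) {A B} (h : NF Q A B) {i : Fin m} {k l : Fin 3} (hkl : l ≠ k)
    (h1 : A i k = 0) (h2 : A i l = 0) (r : Fin 3) : A i r = 0 := by
  by_cases hrk : r = k
  · rw [hrk, h1]
  obtain ⟨A', B', h', hne, hk, i0, hi0, hi0'⟩ := expandA h hr hkl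
  have := H A' B' h'
  unfold GoodA at this
  push Not at this
  have := this k i i0 l r (by rw [hk i h2, h1]) hi0'
  rw [hne _ _ hkl, hne _ _ hrk, hne _ _ hkl, h2, hne _ _ hrk] at this
  simp at this
  rcases this with h | h
  · exact h
  · exact absurd h hi0.ne'

theorem otherpos {m n : ℕ} {Q : Matrix (Fin m) (Fin n) ℝ} (hr : Q.rank = 3)
    (H : ∀ A B, NF Q A B → ¬ GoodA A) {A B} (h : NF Q A B) {i : Fin m} {k l r : Fin 3}
    (h1 : A i k = 0) (h2 : A i l ≠ 0) (hrk : r ≠ k) : 0 < A i r := by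
  refine lt_of_le_of_ne (h.1 _ _) fun h0 => h2 (twozero hr H h hrk h1 h0.symm l)

theorem stepZ {m n : ℕ} {Q : Matrix (Fin m) (Fin n) ℝ} (hr : Q.rank = 3)
    (H : ∀ A B, NF Q A B → ¬ GoodA A) {A B} (h : NF Q A B) (k : Fin 3) :
    ∃ A' B', NF Q A' B' ∧ (∃ i, A' i k = 0 ∧ ∃ l, A' i l ≠ 0) ∧
     ∀ k', k' ≠ k → (∃ i, A i k' = 0 ∧ ∃ l, A i l ≠ 0) → (∃ i, A' i k' = 0 ∧ ∃ l, A' i l ≠ 0) := by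
  obtain ⟨l, hl⟩ : ∃ l : Fin 3, l ≠ k := exists_ne k
  obtain ⟨A', B', h', hne, hk, i0, hi0, hi0'⟩ := expandA h hr hl
  refine ⟨A', B', h', ⟨i0, hi0', l, by rw [hne _ _ hl]; exact hi0.ne'⟩, ?_⟩
  rintro k' hk' ⟨i, hi, s, hs⟩
  obtain ⟨r, hrk, hrk'⟩ : ∃ r : Fin 3, r ≠ k ∧ r ≠ k' := by
    clear * -; revert k k'; decide
  exact ⟨i, by rw [hne _ _ hk', hi], r, by rw [hne _ _ hrk]; exact (otherpos hr H h hi hs hrk').ne'⟩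

theorem allZ {m n : ℕ} {Q : Matrix (Fin m) (Fin n) ℝ} (hr : Q.rank = 3)
    (H : ∀ A B, NF Q A B → ¬ GoodA A) {A B} (h : NF Q A B) :
    ∃ A' B', NF Q A' B' ∧ ∀ k, ∃ i, A' i k = 0 ∧ ∀ r, r ≠ k → 0 < A' i r := by
  obtain ⟨A1, B1, h1, z1, -⟩ := stepZ hr H h 0
  obtain ⟨A2, B2, h2, z2, y2⟩ := stepZ hr H h1 1
  obtain ⟨A3, B3, h3, z3, y3⟩ := stepZ hr H h2 2
  refine ⟨A3, B3, h3, ?_⟩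
  have key : ∀ k, ∃ i, A3 i k = 0 ∧ ∃ l, A3 i l ≠ 0 := by
    intro k; fin_cases k
    · exact y3 0 (by decide) (y2 0 (by decide) z1)
    · exact y3 1 (by decide) z2
    · exact z3
  intro k
  obtain ⟨i, hi, l, hl⟩ := key k
  exact ⟨i, hi, fun r hrk => otherpos hr H h3 hi hl hrk⟩

/-- ratio on each edge -/
theorem ratio {m n : ℕ} {Q : Matrix (Fin m) (Fin n) ℝ} (hr : Q.rank = 3)
    (H : ∀ A B, NF Q A B → ¬ GoodA A) {A B} (h : NF Q A B) (hnz : ∀ i, ∃ l, A i l ≠ 0)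
    (k l r : Fin 3) (hl : l ≠ k) (hrk : r ≠ k) :
    ∃ p q : ℝ, 0 < p ∧ 0 < q ∧ ∀ i, A i k = 0 → ∃ c, 0 < c ∧ A i l = c * p ∧ A i r = c * q := by
  by_cases he : ∃ i, A i k = 0
  · obtain ⟨i, hi⟩ := he
    obtain ⟨s, hs⟩ := hnz i
    have hp := otherpos hr H h hi hs hl
    have hq := otherpos hr H h hi hs hrk
    refine ⟨A i l, A i r, hp, hq, fun i' hi' => ?_⟩
    obtain ⟨s', hs'⟩ := hnz i'
    have hp' := otherpos hr H h hi' hs' hl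
    have := H A B h
    unfold GoodA at this
    push Not at this
    have := this k i i' l r hi hi'
    refine ⟨A i' l / A i l, by positivity, by field_simp, by field_simp; linarith⟩
  · push Not at he
    exact ⟨1, 1, one_pos, one_pos, fun i hi => absurd hi (he i)⟩

theorem rank_tr {m n : ℕ} {Q : Matrix (Fin m) (Fin n) ℝ} (hr : Q.rank = 3) : Qᵀ.rank = 3 := by
  rw [Matrix.rank_transpose, hr]

theorem signs (c0 d0 c1 d1 c2 d2 : ℝ) (hc0 : 0 < c0) (hd0 : 0 < d0) (hc1 : 0 < c1) (hd1 : 0 < d1)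
    (_ : 0 < c2) (_ : 0 < d2) : ∃ s0 s1 s2 : ℝ, 0 < s0 * s1 ∧ 0 < s1 * s2 ∧ 0 < s2 * s0 ∧
      0 ≤ s1 * c0 - s2 * d0 ∧ 0 ≤ s2 * c1 - s0 * d1 ∧ 0 ≤ s0 * c2 - s1 * d2 := by
  rcases le_total (d0 * d1 * d2) (c0 * c1 * c2) with h | h
  · refine ⟨c1 * c0, d0 * d1, c0 * d1, by positivity, by positivity, by positivity, ?_, ?_, ?_⟩ <;>
      nlinarith
  · refine ⟨-(c1 * c0), -(d0 * d1), -(c0 * d1), ?_, ?_, ?_, ?_, ?_, ?_⟩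
    · have : 0 < c1 * c0 * (d0 * d1) := by positivity
      linarith
    · have : 0 < c0 * d1 * (d0 * d1) := by positivity
      linarith
    · have : 0 < c1 * c0 * (c0 * d1) := by positivity
      linarith
    all_goals nlinarith

/-- eventual positivity of an edge constraint -/
theorem edge_ev (a10 a12 a20 a21 s1 s2 p q b0 b1 b2 : ℝ) (h10 : 0 < a10) (h12 : 0 < a12)
    (h20 : 0 < a20) (h21 : 0 < a21) (hp : 0 < p) (hq : 0 < q) (hs : 0 < s1 * s2)
    (hl : 0 ≤ s1 * (a12 * p) - s2 * (a21 * q)) (hb0 : 0 ≤ b0)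
    (hb : b0 = 0 → ∃ c, 0 < c ∧ b1 = c * p ∧ b2 = c * q) :
    ∀ᶠ τ : ℝ in 𝓝[>] 0, 0 < (1 + (τ * s1) * (τ * s2) * a20 * a10) * b0
      + ((τ * s1) * a12 + (τ * s2) * a21 * (τ * s1) * a10) * b1
      + ((τ * s1) * (τ * s2) * a12 * a20 - (τ * s2) * a21) * b2 := by
  rcases hb0.eq_or_lt with h | h
  · obtain ⟨c, hc, rfl, rfl⟩ := hb h.symm
    filter_upwards [self_mem_nhdsWithin] with τ hτ
    have hτ : 0 < τ := hτ
    rw [← h]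
    have e : (1 + (τ * s1) * (τ * s2) * a20 * a10) * 0
      + ((τ * s1) * a12 + (τ * s2) * a21 * (τ * s1) * a10) * (c * p)
      + ((τ * s1) * (τ * s2) * a12 * a20 - (τ * s2) * a21) * (c * q)
      = τ * c * (s1 * (a12 * p) - s2 * (a21 * q))
        + τ ^ 2 * c * (s1 * s2) * (a21 * a10 * p + a12 * a20 * q) := by ring
    rw [e]
    have : 0 < τ ^ 2 * c * (s1 * s2) * (a21 * a10 * p + a12 * a20 * q) := by positivity
    have := mul_nonneg (mul_nonneg hτ.le hc.le) hl
    linarith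
  · refine nhdsWithin_le_nhds ?_
    refine ContinuousAt.eventually_lt (f := fun _ => (0:ℝ)) (by fun_prop) (by fun_prop) ?_
    simpa using h

theorem vert_ev (x y z a b s : ℝ) (hx : 0 ≤ x) (h : x = 0 → a * y = b * z) :
    ∀ᶠ τ : ℝ in 𝓝[>] 0, 0 ≤ x + (τ * s) * (a * y - b * z) := by
  rcases hx.eq_or_lt with h0 | h0
  · refine Eventually.of_forall fun τ => ?_
    rw [h h0.symm, ← h0]; simp
  · refine nhdsWithin_le_nhds ?_
    have : ∀ᶠ τ : ℝ in 𝓝 0, 0 < x + (τ * s) * (a * y - b * z) := by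
      refine ContinuousAt.eventually_lt (f := fun _ => (0:ℝ)) (by fun_prop) (by fun_prop) ?_
      simpa using h0
    exact this.mono fun _ => le_of_lt

theorem coreT {m n : ℕ} {Q : Matrix (Fin m) (Fin n) ℝ} (hr : Q.rank = 3)
    (hcol : ∀ j, ∃ i, Q i j ≠ 0)
    (HA : ∀ A B, NF Q A B → ¬ GoodA A) (HB : ∀ A B, NF Q A B → ¬ GoodA Bᵀ)
    (hex : ∃ A B, NF Q A B) : ∃ A B, NF Q A B ∧ ∀ k j, 0 < B k j := by
  obtain ⟨A0, B0, h0⟩ := hex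
  obtain ⟨A, B, h, hZ⟩ := allZ hr HA h0
  clear h0
  have HB' : ∀ A B, NF Qᵀ A B → ¬ GoodA A := by
    intro A B h
    have := HB Bᵀ Aᵀ (by simpa using h.tr)
    simpa using this
  have hnz : ∀ j, ∃ l, Bᵀ j l ≠ 0 := by
    intro j
    by_contra! hc
    obtain ⟨i, hi⟩ := hcol j
    apply hi
    rw [h.2.2, Matrix.mul_apply]
    exact Finset.sum_eq_zero fun l _ => by rw [← Matrix.transpose_apply B, hc l, mul_zero]
  obtain ⟨p0, q0, hp0, hq0, r0⟩ := ratio (rank_tr hr) HB' h.tr hnz 0 1 2 (by decide) (by decide)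
  obtain ⟨p1, q1, hp1, hq1, r1⟩ := ratio (rank_tr hr) HB' h.tr hnz 1 2 0 (by decide) (by decide)
  obtain ⟨p2, q2, hp2, hq2, r2⟩ := ratio (rank_tr hr) HB' h.tr hnz 2 0 1 (by decide) (by decide)
  obtain ⟨i0, z0, y0⟩ := hZ 0
  obtain ⟨i1, z1, y1⟩ := hZ 1
  obtain ⟨i2, z2, y2⟩ := hZ 2
  have a01 := y0 1 (by decide)
  have a02 := y0 2 (by decide)
  have a10 := y1 0 (by decide)
  have a12 := y1 2 (by decide)
  have a20 := y2 0 (by decide)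
  have a21 := y2 1 (by decide)
  obtain ⟨s0, s1, s2, h01, h12, h20, l0, l1, l2⟩ := signs (A i1 2 * p0) (A i2 1 * q0)
    (A i2 0 * p1) (A i0 2 * q1) (A i0 1 * p2) (A i1 0 * q2) (by positivity) (by positivity)
    (by positivity) (by positivity) (by positivity) (by positivity)
  have e0 : ∀ j, _ := fun j => edge_ev (A i1 0) (A i1 2) (A i2 0) (A i2 1) s1 s2 p0 q0 (B 0 j)
    (B 1 j) (B 2 j) a10 a12 a20 a21 hp0 hq0 h12 l0 (h.2.1 _ _) (r0 j)
  have e1 : ∀ j, _ := fun j => edge_ev (A i2 1) (A i2 0) (A i0 1) (A i0 2) s2 s0 p1 q1 (B 1 j)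
    (B 2 j) (B 0 j) a21 a20 a01 a02 hp1 hq1 h20 l1 (h.2.1 _ _) (r1 j)
  have e2 : ∀ j, _ := fun j => edge_ev (A i0 2) (A i0 1) (A i1 2) (A i1 0) s0 s1 p2 q2 (B 2 j)
    (B 0 j) (B 1 j) a02 a01 a12 a10 hp2 hq2 h01 l2 (h.2.1 _ _) (r2 j)
  have hA := HA A B h
  unfold GoodA at hA
  push Not at hA
  have f0 : ∀ i, _ := fun i => vert_ev (A i 0) (A i 1) (A i 2) (A i0 2) (A i0 1) s0 (h.1 _ _)
    (fun hh => by have := hA 0 i i0 1 2 hh z0; linarith)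
  have f1 : ∀ i, _ := fun i => vert_ev (A i 1) (A i 2) (A i 0) (A i1 0) (A i1 2) s1 (h.1 _ _)
    (fun hh => by have := hA 1 i i1 2 0 hh z1; linarith)
  have f2 : ∀ i, _ := fun i => vert_ev (A i 2) (A i 0) (A i 1) (A i2 1) (A i2 0) s2 (h.1 _ _)
    (fun hh => by have := hA 2 i i2 0 1 hh z2; linarith)
  let M : ℝ → Matrix (Fin 3) (Fin 3) ℝ := fun τ =>
    !![1, -(τ * s1) * A i1 2, (τ * s2) * A i2 1;
       (τ * s0) * A i0 2, 1, -(τ * s2) * A i2 0;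
       -(τ * s0) * A i0 1, (τ * s1) * A i1 0, 1]
  have ed : ∀ᶠ τ : ℝ in 𝓝[>] 0, 0 < (M τ).det := by
    refine nhdsWithin_le_nhds ?_
    have : ∀ τ, (M τ).det = _ := fun τ => Matrix.det_fin_three (M τ)
    simp only [this, M]
    simp
    refine ContinuousAt.eventually_lt (f := fun _ => (0:ℝ)) (by fun_prop) (by fun_prop) ?_
    simp
  obtain ⟨τ, g0, g1, g2, k0, k1, k2, hd⟩ := ((eventually_all.2 e0).and ((eventually_all.2 e1).and
    ((eventually_all.2 e2).and ((eventually_all.2 f0).and ((eventually_all.2 f1).and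
    ((eventually_all.2 f2).and ed)))))).exists
  have hB : ∀ k j, 0 < ((M τ).adjugate * B) k j := by
    intro k j
    rw [Matrix.adjugate_fin_three_of]
    fin_cases k
    · convert g0 j using 1
      simp [Matrix.mul_apply, Fin.sum_univ_three]; ring
    · convert g1 j using 1
      simp [Matrix.mul_apply, Fin.sum_univ_three]; ring
    · convert g2 j using 1
      simp [Matrix.mul_apply, Fin.sum_univ_three]; ring
  have hB' : ∀ k j, 0 < ((M τ).det⁻¹ • ((M τ).adjugate * B)) k j := by
    intro k j
    exact mul_pos (inv_pos.2 hd) (hB k j)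
  refine ⟨A * M τ, (M τ).det⁻¹ • ((M τ).adjugate * B), ⟨?_, fun k j => (hB' k j).le, ?_⟩, hB'⟩
  · intro i k
    fin_cases k
    · convert k0 i using 1
      simp [M, Matrix.mul_apply, Fin.sum_univ_three]; ring
    · convert k1 i using 1
      simp [M, Matrix.mul_apply, Fin.sum_univ_three]; ring
    · convert k2 i using 1
      simp [M, Matrix.mul_apply, Fin.sum_univ_three]; ring
  · rw [Matrix.mul_smul, Matrix.mul_assoc, ← Matrix.mul_assoc (M τ), Matrix.mul_adjugate,
      Matrix.smul_mul, Matrix.one_mul, Matrix.mul_smul, smul_smul, inv_mul_cancel₀ hd.ne', one_smul]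
    exact h.2.2

theorem NF.normalize {m n : ℕ} {Q : Matrix (Fin m) (Fin n) ℝ} {A B} (h : NF Q A B)
    (hr : Q.rank = 3) : ∃ A' B', NF Q A' B' ∧ ∀ k, ∑ i, A' i k = 1 := by
  have hs : ∀ k, 0 < ∑ i, A i k := fun k => by
    obtain ⟨i, hi⟩ := h.colpos hr k
    exact Finset.sum_pos' (fun i _ => h.1 i k) ⟨i, Finset.mem_univ _, hi⟩
  refine ⟨Matrix.of fun i k => A i k / ∑ i, A i k, Matrix.of fun k j => (∑ i, A i k) * B k j,
    ⟨fun i k => div_nonneg (h.1 _ _) (hs k).le, fun k j => mul_nonneg (hs k).le (h.2.1 _ _), ?_⟩, ?_⟩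
  · rw [h.2.2]
    ext i j
    simp only [Matrix.mul_apply, Matrix.of_apply]
    refine Finset.sum_congr rfl fun k _ => ?_
    have := (hs k).ne'
    field_simp
  · intro k
    simp only [Matrix.of_apply]
    rw [← Finset.sum_div, div_self (hs k).ne']

/-- contraction parameter family -/
def dil {m n : ℕ} (P : Matrix (Fin m) (Fin n) ℝ) (u : Fin m → ℝ) (w : Fin n → ℝ) (μ : ℝ) :
    Matrix (Fin m) (Fin n) ℝ := Matrix.of fun i j => P i j - μ * (u i * w j)

theorem dil_colsum {m n : ℕ} {P : Matrix (Fin m) (Fin n) ℝ} {u : Fin m → ℝ} {w : Fin n → ℝ}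
    (hw : ∀ j, ∑ i, P i j = w j) (hu : ∑ i, u i = 1) (μ : ℝ) (j : Fin n) :
    ∑ i, dil P u w μ i j = (1 - μ) * w j := by
  simp only [dil, Matrix.of_apply, Finset.sum_sub_distrib, hw, ← Finset.mul_sum, ← Finset.sum_mul, hu]
  ring

theorem dil_rowsum {m n : ℕ} {P : Matrix (Fin m) (Fin n) ℝ} {u : Fin m → ℝ} {w : Fin n → ℝ}
    {W : ℝ} (hW : ∑ j, w j = W)
    (huP : ∀ i, ∑ j, P i j = u i * W) (μ : ℝ) (i : Fin m) :
    ∑ j, dil P u w μ i j = (1 - μ) * (u i * W) := by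
  simp only [dil, Matrix.of_apply, Finset.sum_sub_distrib, huP, ← Finset.mul_sum, hW]
  ring

theorem dil_rank {m n : ℕ} {P : Matrix (Fin m) (Fin n) ℝ} {u : Fin m → ℝ} {w : Fin n → ℝ}
    (hw : ∀ j, ∑ i, P i j = w j) (hu : ∑ i, u i = 1) {μ : ℝ} (hμ : μ < 1)
    {A : Matrix (Fin m) (Fin 3) ℝ} {B : Matrix (Fin 3) (Fin n) ℝ}
    (h : dil P u w μ = A * B) (hr : P.rank = 3) : (dil P u w μ).rank = 3 := by
  have h1 : (dil P u w μ).rank ≤ 3 := by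
    rw [h]
    refine (Matrix.rank_mul_le_left A B).trans ?_
    have := A.rank_le_width
    simpa using this
  have h2 : P = ((1 : Matrix (Fin m) (Fin m) ℝ) +
      (μ / (1 - μ)) • vecMulVec u (1 : Fin m → ℝ)) * dil P u w μ := by
    ext i j
    have hc := dil_colsum hw hu μ j
    have h3 : (1 - μ) ≠ 0 := by linarith
    rw [Matrix.add_mul, Matrix.one_mul, Matrix.smul_mul, Matrix.add_apply, Matrix.smul_apply,
      Matrix.mul_apply]
    simp only [vecMulVec_apply, Pi.one_apply, mul_one, ← Finset.mul_sum, hc]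
    simp only [dil, Matrix.of_apply, smul_eq_mul]
    field_simp
    ring
  have h3 : P.rank ≤ (dil P u w μ).rank := by
    conv_lhs => rw [h2]
    exact Matrix.rank_mul_le_right _ _
  omega

theorem goodExists {m n : ℕ} {P : Matrix (Fin m) (Fin n) ℝ} (hr : P.rank = 3)
    (hP : ∀ i j, 0 ≤ P i j) (hcol : ∀ j, ∃ i, P i j ≠ 0)
    (hex : ∃ A B, NF P A B) : ∃ A B, NF P A B ∧ (GoodA A ∨ GoodA Bᵀ) := by
  obtain ⟨w, hw⟩ : ∃ w : Fin n → ℝ, ∀ j, ∑ i, P i j = w j := ⟨_, fun _ => rfl⟩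
  have hwpos : ∀ j, 0 < w j := fun j => by
    obtain ⟨i, hi⟩ := hcol j
    rw [← hw]
    exact Finset.sum_pos' (fun i _ => hP i j) ⟨i, Finset.mem_univ _, lt_of_le_of_ne (hP _ _) hi.symm⟩
  have hn : Nonempty (Fin n) := by
    by_contra hc
    have := P.rank_le_width
    rcases Nat.eq_zero_or_pos n with h | h
    · omega
    · exact hc ⟨⟨0, h⟩⟩
  obtain ⟨W, hW⟩ : ∃ W, ∑ j, w j = W := ⟨_, rfl⟩
  have hWpos : 0 < W := hW ▸ Finset.sum_pos (fun j _ => hwpos j) Finset.univ_nonempty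
  obtain ⟨u, hu'⟩ : ∃ u : Fin m → ℝ, ∀ i, u i = (∑ j, P i j) / W := ⟨_, fun _ => rfl⟩
  have huP : ∀ i, ∑ j, P i j = u i * W := fun i => by rw [hu']; field_simp
  have hu0 : ∀ i, 0 ≤ u i := fun i => by
    rw [hu']; exact div_nonneg (Finset.sum_nonneg fun j _ => hP i j) hWpos.le
  have hu : ∑ i, u i = 1 := by
    simp only [hu', ← Finset.sum_div]
    rw [div_eq_one_iff_eq hWpos.ne', ← hW]
    refine Finset.sum_comm.trans ?_
    exact Finset.sum_congr rfl fun j _ => hw j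
  by_contra hno
  push Not at hno
  -- transfers
  have HA : ∀ μ, 0 ≤ μ → μ < 1 → ∀ A B, NF (dil P u w μ) A B → ¬ GoodA A := by
    intro μ h0 h1 A B h hg
    have hm : 0 < 1 - μ := by linarith
    refine (hno A (Matrix.of fun k j => B k j + μ / ((1 - μ) * W) * (∑ j', B k j') * w j)
      ⟨h.1, fun k j => ?_, ?_⟩).1 hg
    · have := h.2.1 k j
      have h2 : 0 ≤ ∑ j', B k j' := Finset.sum_nonneg fun j' _ => h.2.1 k j'
      have := hwpos j
      simp only [Matrix.of_apply]
      positivity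
    · ext i j
      have e1 : dil P u w μ i j = ∑ k, A i k * B k j := by rw [h.2.2, Matrix.mul_apply]
      have e2 : (1 - μ) * (u i * W) = ∑ k, A i k * ∑ j, B k j := by
        rw [← dil_rowsum hW huP μ i, h.2.2]
        simp only [Matrix.mul_apply]
        rw [Finset.sum_comm]
        simp only [Finset.mul_sum]
      simp only [Matrix.mul_apply, Matrix.of_apply, mul_add, Finset.sum_add_distrib, ← e1]
      have e3 : ∑ k, A i k * (μ / ((1 - μ) * W) * (∑ j', B k j') * w j)
          = μ / ((1 - μ) * W) * w j * ∑ k, A i k * ∑ j, B k j := by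
        rw [Finset.mul_sum]
        exact Finset.sum_congr rfl fun k _ => by ring
      rw [e3, ← e2]
      simp only [dil, Matrix.of_apply]
      field_simp
      ring
  have HB : ∀ μ, 0 ≤ μ → μ < 1 → ∀ A B, NF (dil P u w μ) A B → ¬ GoodA Bᵀ := by
    intro μ h0 h1 A B h hg
    have hm : 0 < 1 - μ := by linarith
    refine (hno (Matrix.of fun i k => A i k + μ / (1 - μ) * u i * (∑ i', A i' k)) B
      ⟨fun i k => ?_, h.2.1, ?_⟩).2 hg
    · have := h.1 i k
      have h2 : 0 ≤ ∑ i', A i' k := Finset.sum_nonneg fun i' _ => h.1 i' k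
      have := hu0 i
      simp only [Matrix.of_apply]
      positivity
    · ext i j
      have e1 : dil P u w μ i j = ∑ k, A i k * B k j := by rw [h.2.2, Matrix.mul_apply]
      have e2 : (1 - μ) * w j = ∑ k, (∑ i', A i' k) * B k j := by
        rw [← dil_colsum hw hu μ j, h.2.2]
        simp only [Matrix.mul_apply]
        rw [Finset.sum_comm]
        simp only [Finset.sum_mul]
      simp only [Matrix.mul_apply, Matrix.of_apply, add_mul, Finset.sum_add_distrib, ← e1]
      have e3 : ∑ k, (μ / (1 - μ) * u i * (∑ i', A i' k)) * B k j
          = μ / (1 - μ) * u i * ∑ k, (∑ i', A i' k) * B k j := by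
        rw [Finset.mul_sum]
        exact Finset.sum_congr rfl fun k _ => by ring
      rw [e3, ← e2]
      simp only [dil, Matrix.of_apply]
      field_simp
      ring
  -- the compact set
  let K : Set (ℝ × (Fin m → Fin 3 → ℝ) × (Fin 3 → Fin n → ℝ)) :=
    {x | (0 ≤ x.1 ∧ x.1 ≤ 1) ∧ (∀ i k, 0 ≤ x.2.1 i k) ∧ (∀ k j, 0 ≤ x.2.2 k j) ∧
      (∀ k, ∑ i, x.2.1 i k = 1) ∧
      (∀ i j, P i j - x.1 * (u i * w j) = ∑ k, x.2.1 i k * x.2.2 k j)}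
  have hKsub : K ⊆ Set.Icc (0, 0, 0) (1, fun _ _ => 1, fun _ j => w j) := by
    rintro ⟨μ, A, B⟩ ⟨⟨h0, h1⟩, hA, hB, hs, he⟩
    simp only at h0 h1 hA hB hs he
    refine ⟨⟨h0, hA, hB⟩, ⟨h1, fun i k => ?_, fun k j => ?_⟩⟩
    · rw [← hs k]
      exact Finset.single_le_sum (f := fun i => A i k) (fun i _ => hA i k) (Finset.mem_univ i)
    · have e2 : (1 - μ) * w j = ∑ k, B k j := by
        rw [← dil_colsum hw hu μ j]
        simp only [dil, Matrix.of_apply, he]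
        rw [Finset.sum_comm]
        simp only [← Finset.sum_mul, hs, one_mul]
      have e3 := Finset.single_le_sum (f := fun k => B k j) (fun k _ => hB k j) (Finset.mem_univ k)
      have := mul_nonneg h0 (hwpos j).le
      simp only at e3 ⊢
      linarith
  have hKcl : IsClosed K := by
    simp only [K, Set.ofPred_and, Set.ofPred_forall]
    refine IsClosed.inter (IsClosed.inter ?_ ?_) (IsClosed.inter ?_ (IsClosed.inter ?_
      (IsClosed.inter ?_ ?_)))
    · exact isClosed_le (by fun_prop) (by fun_prop)
    · exact isClosed_le (by fun_prop) (by fun_prop)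
    · exact isClosed_iInter fun i => isClosed_iInter fun k => isClosed_le (by fun_prop) (by fun_prop)
    · exact isClosed_iInter fun i => isClosed_iInter fun k => isClosed_le (by fun_prop) (by fun_prop)
    · exact isClosed_iInter fun k => isClosed_eq (by fun_prop) (by fun_prop)
    · exact isClosed_iInter fun i => isClosed_iInter fun k => isClosed_eq (by fun_prop) (by fun_prop)
  have hKc : IsCompact K := isCompact_Icc.of_isClosed_subset hKcl hKsub
  have memK : ∀ μ, 0 ≤ μ → μ < 1 → ∀ A B, NF (dil P u w μ) A B → ∃ x ∈ K, x.1 = μ := by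
    intro μ h0 h1 A B h
    obtain ⟨A', B', h', hs⟩ := h.normalize (dil_rank hw hu h1 h.2.2 hr)
    refine ⟨(μ, A', B'), ⟨⟨h0, h1.le⟩, h'.1, h'.2.1, hs, fun i j => ?_⟩, rfl⟩
    exact congrFun (congrFun h'.2.2 i) j
  have hKne : K.Nonempty := by
    obtain ⟨A, B, h⟩ := hex
    have e : dil P u w 0 = P := by ext i j; simp [dil]
    obtain ⟨x, hx, -⟩ := memK 0 le_rfl one_pos A B (by rw [e]; exact h)
    exact ⟨x, hx⟩
  obtain ⟨⟨μ, A0, B0⟩, hx, hmax⟩ := hKc.exists_isMaxOn hKne (f := fun x => x.1) (by fun_prop)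
  obtain ⟨⟨h0, h1⟩, hA, hB, hs, he⟩ := hx
  simp only at h0 h1 hA hB hs he
  have hNF : NF (dil P u w μ) (Matrix.of A0) (Matrix.of B0) := by
    refine ⟨hA, hB, ?_⟩
    ext i j
    simp only [dil, Matrix.mul_apply, Matrix.of_apply, he]
  have hlt : μ < 1 := by
    refine lt_of_le_of_ne h1 fun h => ?_
    subst h
    have hz : ∀ i j, dil P u w 1 i j = 0 := by
      intro i j
      have hnn : ∀ i, 0 ≤ dil P u w 1 i j := fun i => by
        simp only [dil, Matrix.of_apply, he]
        exact Finset.sum_nonneg fun k _ => mul_nonneg (hA i k) (hB k j)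
      have := dil_colsum hw hu 1 j
      rw [sub_self, zero_mul, Finset.sum_eq_zero_iff_of_nonneg (fun i _ => hnn i)] at this
      exact this i (Finset.mem_univ _)
    have : P = vecMulVec u w := by
      ext i j
      have := hz i j
      simp only [dil, Matrix.of_apply, one_mul] at this
      rw [vecMulVec_apply]; linarith
    have h2 := Matrix.rank_vecMulVec_le u w
    rw [← this] at h2
    omega
  have hm : 0 < 1 - μ := by linarith
  obtain ⟨A, B, h, hpos⟩ := coreT (dil_rank hw hu hlt hNF.2.2 hr) (fun j => by
    by_contra! hc
    have := dil_colsum hw hu μ j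
    rw [Finset.sum_eq_zero (fun i _ => hc i)] at this
    exact (mul_pos hm (hwpos j)).ne this) (HA μ h0 hlt) (HB μ h0 hlt) ⟨_, _, hNF⟩
  have ev1 : ∀ k j, ∀ᶠ ε : ℝ in 𝓝[>] 0, 0 < B k j - ε / ((1 - μ) * W) * (∑ j', B k j') * w j := by
    intro k j
    refine nhdsWithin_le_nhds ?_
    refine ContinuousAt.eventually_lt (f := fun _ => (0:ℝ)) (by fun_prop) (by fun_prop) ?_
    simpa using hpos k j
  have ev2 : ∀ᶠ ε : ℝ in 𝓝[>] 0, μ + ε < 1 := by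
    refine nhdsWithin_le_nhds ?_
    refine ContinuousAt.eventually_lt (g := fun _ => (1:ℝ)) (by fun_prop) (by fun_prop) ?_
    simpa using hlt
  obtain ⟨ε, g1, g2, hε⟩ := ((eventually_all.2 fun k => eventually_all.2 (ev1 k)).and
    (ev2.and self_mem_nhdsWithin)).exists
  have hε : 0 < ε := hε
  have hN : NF (dil P u w (μ + ε)) A
      (Matrix.of fun k j => B k j - ε / ((1 - μ) * W) * (∑ j', B k j') * w j) := by
    refine ⟨h.1, fun k j => (g1 k j).le, ?_⟩
    ext i j
    have e1 : dil P u w μ i j = ∑ k, A i k * B k j := by rw [h.2.2, Matrix.mul_apply]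
    have e2 : (1 - μ) * (u i * W) = ∑ k, A i k * ∑ j, B k j := by
      rw [← dil_rowsum hW huP μ i, h.2.2]
      simp only [Matrix.mul_apply]
      rw [Finset.sum_comm]
      simp only [Finset.mul_sum]
    simp only [Matrix.mul_apply, Matrix.of_apply, mul_sub, Finset.sum_sub_distrib, ← e1]
    have e3 : ∑ k, A i k * (ε / ((1 - μ) * W) * (∑ j', B k j') * w j)
        = ε / ((1 - μ) * W) * w j * ∑ k, A i k * ∑ j, B k j := by
      rw [Finset.mul_sum]
      exact Finset.sum_congr rfl fun k _ => by ring
    rw [e3, ← e2]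
    simp only [dil, Matrix.of_apply]
    field_simp
    ring
  obtain ⟨x, hxK, hx1⟩ := memK (μ + ε) (by linarith) g2 _ _ hN
  have := hmax hxK
  simp only [Set.mem_ofPred_eq] at this
  linarith

theorem colsum_pos {m n : ℕ} {P : Matrix (Fin m) (Fin n) ℝ} (hP : ∀ i j, 0 ≤ P i j)
    (hcol : ∀ j, ∃ i, P i j ≠ 0) (j : Fin n) : 0 < ∑ i, P i j := by
  obtain ⟨i, hi⟩ := hcol j
  exact Finset.sum_pos' (fun i _ => hP i j) ⟨i, Finset.mem_univ _, lt_of_le_of_ne (hP _ _) hi.symm⟩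

theorem vertexB_nonneg {m n : ℕ} {P : Matrix (Fin m) (Fin n) ℝ} (hP : ∀ i j, 0 ≤ P i j)
    (j : Fin n) (i : Fin m) : 0 ≤ vertexB P j i :=
  div_nonneg (hP _ _) (Finset.sum_nonneg fun i _ => hP i j)

theorem vertexB_sum {m n : ℕ} {P : Matrix (Fin m) (Fin n) ℝ} (hP : ∀ i j, 0 ≤ P i j)
    (hcol : ∀ j, ∃ i, P i j ≠ 0) (j : Fin n) : ∑ i, vertexB P j i = 1 := by
  unfold vertexB
  rw [← Finset.sum_div, div_self (colsum_pos hP hcol j).ne']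

theorem vertexB_eq {m n : ℕ} {P : Matrix (Fin m) (Fin n) ℝ} (hP : ∀ i j, 0 ≤ P i j)
    (hcol : ∀ j, ∃ i, P i j ≠ 0) (i : Fin m) (j : Fin n) :
    P i j = (∑ i, P i j) * vertexB P j i := by
  unfold vertexB
  have := (colsum_pos hP hcol j).ne'
  field_simp

theorem vertexB_span {m n : ℕ} (P : Matrix (Fin m) (Fin n) ℝ) (j : Fin n) :
    vertexB P j ∈ Submodule.span ℝ (Set.range fun j => fun i => P i j) := by
  have : vertexB P j = (∑ i, P i j)⁻¹ • (fun i => P i j) := by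
    ext i; simp [vertexB, div_eq_inv_mul]
  rw [this]
  exact Submodule.smul_mem _ _ (Submodule.subset_span ⟨j, rfl⟩)

theorem rank_span_P {m n : ℕ} (P : Matrix (Fin m) (Fin n) ℝ) :
    P.rank = Module.finrank ℝ (Submodule.span ℝ (Set.range fun j => fun i => P i j)) :=
  Matrix.rank_eq_finrank_span_cols P

theorem lowrank {m n : ℕ} {P : Matrix (Fin m) (Fin n) ℝ} (hP : ∀ i j, 0 ≤ P i j)
    (hcol : ∀ j, ∃ i, P i j ≠ 0) (hr : P.rank < 3) : ∃ A B, NF P A B := by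
  rcases isEmpty_or_nonempty (Fin n) with hn | ⟨⟨j0⟩⟩
  · exact ⟨0, 0, fun _ _ => le_rfl, fun _ _ => le_rfl, by ext i j; exact hn.elim j⟩
  have hcl : Collinear ℝ (Set.range (vertexB P)) := by
    rw [collinear_iff_finrank_le_one]
    set S := Submodule.span ℝ (Set.range fun j => fun i => P i j) with hS
    let φ : (Fin m → ℝ) →ₗ[ℝ] ℝ := ∑ i, LinearMap.proj i
    have hφ : ∀ x, φ x = ∑ i, x i := fun x => by simp [φ]
    have h1 : vectorSpan ℝ (Set.range (vertexB P)) ≤ S ⊓ LinearMap.ker φ := by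
      unfold vectorSpan
      rw [Submodule.span_le]
      rintro x ⟨_, ⟨a, rfl⟩, _, ⟨b, rfl⟩, rfl⟩
      refine ⟨S.sub_mem (vertexB_span P a) (vertexB_span P b), ?_⟩
      simp only [SetLike.mem_coe, LinearMap.mem_ker, vsub_eq_sub, hφ, Pi.sub_apply, Finset.sum_sub_distrib,
        vertexB_sum hP hcol, sub_self]
    have h2 : S ⊓ LinearMap.ker φ < S := by
      refine lt_of_le_of_ne inf_le_left fun h => ?_
      have h3 := vertexB_span P j0
      rw [← hS, ← h] at h3
      have h4 := h3.2
      simp only [SetLike.mem_coe, LinearMap.mem_ker, hφ, vertexB_sum hP hcol] at h4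
      exact one_ne_zero h4
    have h3 := Submodule.finrank_lt_finrank_of_lt h2
    have h4 := Submodule.finrank_mono h1
    rw [rank_span_P, ← hS] at hr
    omega
  obtain ⟨p0, v, hv⟩ := (collinear_iff_exists_forall_eq_smul_vadd _).1 hcl
  have hv' : ∀ j, ∃ t : ℝ, vertexB P j = t • v + p0 := fun j => hv _ ⟨j, rfl⟩
  choose t ht using hv'
  obtain ⟨a, -, ha⟩ := Finset.exists_min_image Finset.univ t ⟨j0, Finset.mem_univ _⟩
  obtain ⟨b, -, hb⟩ := Finset.exists_max_image Finset.univ t ⟨j0, Finset.mem_univ _⟩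
  have hθ : ∀ j, ∃ θ : ℝ, 0 ≤ θ ∧ θ ≤ 1 ∧ t j = (1 - θ) * t a + θ * t b := by
    intro j
    have h1 := ha j (Finset.mem_univ _)
    have h2 := hb j (Finset.mem_univ _)
    rcases (h1.trans h2).eq_or_lt with h | h
    · exact ⟨0, le_rfl, zero_le_one, by linarith⟩
    · have h3 : 0 < t b - t a := by linarith
      refine ⟨(t j - t a) / (t b - t a), div_nonneg (by linarith) h3.le, ?_, ?_⟩
      · rw [div_le_one h3]; linarith
      · field_simp; ring
  choose θ hθ0 hθ1 hθe using hθ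
  refine ⟨Matrix.of fun i k => ![vertexB P a i, vertexB P b i, 0] k,
    Matrix.of fun k j => ![(∑ i, P i j) * (1 - θ j), (∑ i, P i j) * θ j, 0] k, ?_, ?_, ?_⟩
  · intro i k
    fin_cases k <;> simp [vertexB_nonneg hP]
  · intro k j
    have := (colsum_pos hP hcol j).le
    fin_cases k
    · exact mul_nonneg this (by linarith [hθ1 j])
    · exact mul_nonneg this (hθ0 j)
    · simp
  · ext i j
    rw [vertexB_eq hP hcol i j, Matrix.mul_apply, Fin.sum_univ_three]
    simp only [Matrix.of_apply, ht]
    simp [hθe j]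
    ring

theorem vertexB_mem_cone {m n : ℕ} {P : Matrix (Fin m) (Fin n) ℝ} (hP : ∀ i j, 0 ≤ P i j)
    (hcol : ∀ j, ∃ i, P i j ≠ 0) (j : Fin n) : vertexB P j ∈ coneSimplex P := by
  classical
  refine ⟨⟨Pi.single j (∑ i, P i j)⁻¹, fun j' => ?_, ?_⟩, vertexB_nonneg hP j, vertexB_sum hP hcol j⟩
  · by_cases h : j' = j
    · subst h; simpa using (colsum_pos hP hcol j').le
    · simp [h]
  · ext i
    simp [vertexB, div_eq_inv_mul, Pi.single_apply]

theorem mem_hull3 {m : ℕ} {v : Fin 3 → Fin m → ℝ} {x : Fin m → ℝ} :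
    x ∈ convexHull ℝ (Set.range v) ↔
      ∃ c : Fin 3 → ℝ, (∀ k, 0 ≤ c k) ∧ ∑ k, c k = 1 ∧ ∑ k, c k • v k = x := by
  rw [convexHull_range_eq_exists_affineCombination]
  constructor
  · rintro ⟨s, c, h0, h1, rfl⟩
    rw [Finset.affineCombination_eq_linear_combination _ _ _ h1]
    classical
    refine ⟨fun k => if k ∈ s then c k else 0, fun k => ?_, ?_, ?_⟩
    · dsimp only; split_ifs with h
      · exact h0 k h
      · exact le_rfl
    · simpa using h1
    · simp [ite_smul]
  · rintro ⟨c, h0, h1, rfl⟩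
    exact ⟨Finset.univ, c, fun k _ => h0 k, h1,
      Finset.affineCombination_eq_linear_combination _ _ _ h1⟩

theorem backward {m n : ℕ} {P : Matrix (Fin m) (Fin n) ℝ} (hP : ∀ i j, 0 ≤ P i j)
    (hcol : ∀ j, ∃ i, P i j ≠ 0) (v : Fin 3 → (Fin m → ℝ))
    (h1 : coneSimplex P ⊆ convexHull ℝ (Set.range v))
    (h2 : convexHull ℝ (Set.range v) ⊆ spanSimplex P) : ∃ A B, NF P A B := by
  choose c hc0 hc1 hce using fun j => mem_hull3.1 (h1 (vertexB_mem_cone hP hcol j))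
  refine ⟨Matrix.of fun i k => v k i, Matrix.of fun k j => (∑ i, P i j) * c j k, ?_, ?_, ?_⟩
  · intro i k
    exact (h2 (subset_convexHull ℝ _ ⟨k, rfl⟩)).2.1 i
  · intro k j
    exact mul_nonneg (colsum_pos hP hcol j).le (hc0 j k)
  · ext i j
    rw [vertexB_eq hP hcol i j, ← hce j, Matrix.mul_apply]
    simp only [Finset.sum_apply, Pi.smul_apply, smul_eq_mul, Matrix.of_apply, Finset.mul_sum]
    exact Finset.sum_congr rfl fun k _ => by ring

theorem forward {m n : ℕ} {P : Matrix (Fin m) (Fin n) ℝ} (hr : P.rank = 3)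
    (hP : ∀ i j, 0 ≤ P i j) (hcol : ∀ j, ∃ i, P i j ≠ 0)
    {A B} (h : NF P A B) (hg : GoodA A ∨ GoodA Bᵀ) :
    ∃ v : Fin 3 → (Fin m → ℝ), AffineIndependent ℝ v ∧
            coneSimplex P ⊆ convexHull ℝ (Set.range v) ∧
            convexHull ℝ (Set.range v) ⊆ spanSimplex P ∧
            ((∃ i : Fin 3, v i ∈ Set.extremePoints ℝ (spanSimplex P)) ∨
              (∃ (i k : Fin 3) (j₁ j₂ : Fin n), i ≠ k ∧ vertexB P j₁ ≠ vertexB P j₂ ∧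
                vertexB P j₁ ∈ segment ℝ (v i) (v k) ∧
                vertexB P j₂ ∈ segment ℝ (v i) (v k))) := by
  have hs : ∀ k, 0 < ∑ i, A i k := fun k => by
    obtain ⟨i, hi⟩ := h.colpos hr k
    exact Finset.sum_pos' (fun i _ => h.1 i k) ⟨i, Finset.mem_univ _, hi⟩
  obtain ⟨s, hse⟩ : ∃ s : Fin 3 → ℝ, ∀ k, ∑ i, A i k = s k := ⟨_, fun _ => rfl⟩
  simp only [hse] at hs
  have hli := h.li hr
  obtain ⟨v, hv⟩ : ∃ v : Fin 3 → Fin m → ℝ, ∀ k, v k = (s k)⁻¹ • A.col k := ⟨_, fun _ => rfl⟩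
  have hvA : ∀ i k, A i k = s k * v k i := fun i k => by
    have := (hs k).ne'
    rw [hv]; simp [Matrix.col_apply]; field_simp
  have hvs : ∀ k, ∑ i, v k i = 1 := fun k => by
    have e := hse k
    simp only [hvA, ← Finset.mul_sum] at e
    have := (hs k).ne'
    field_simp at e
    exact e
  have hv0 : ∀ k i, 0 ≤ v k i := fun k i => by
    rw [hv]; exact mul_nonneg (inv_nonneg.2 (hs k).le) (h.1 i k)
  have hvli : LinearIndependent ℝ v := by
    have := hli.units_smul (fun k => (Units.mk0 (s k) (hs k).ne')⁻¹)
    convert this using 1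
    ext1 k
    rw [hv]; rfl
  -- spans
  have hspan : Submodule.span ℝ (Set.range fun j => fun i => P i j)
      = Submodule.span ℝ (Set.range A.col) := by
    refine Submodule.eq_of_le_of_finrank_eq ?_ ?_
    · rw [Submodule.span_le]
      rintro _ ⟨j, rfl⟩
      have : (fun i => P i j) = ∑ k, B k j • A.col k := by
        ext i
        rw [h.2.2]
        simp [Matrix.mul_apply, mul_comm]
      simp only [this]
      exact Submodule.sum_mem _ fun k _ => Submodule.smul_mem _ _ (Submodule.subset_span ⟨k, rfl⟩)
    · rw [← rank_span_P, hr, finrank_span_eq_card hli]; simp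
  have hvspan : ∀ k, v k ∈ spanSimplex P := fun k => by
    refine ⟨?_, hv0 k, hvs k⟩
    rw [hspan, hv]
    exact Submodule.smul_mem _ _ (Submodule.subset_span ⟨k, rfl⟩)
  have hPv : ∀ i j, P i j = ∑ k, s k * B k j * v k i := fun i j => by
    rw [h.2.2, Matrix.mul_apply]
    exact Finset.sum_congr rfl fun k _ => by rw [hvA]; ring
  have hconv : Convex ℝ (spanSimplex P) := (Submodule.convex _).inter (convex_stdSimplex ℝ _)
  refine ⟨v, hvli.affineIndependent, ?_, convexHull_min ?_ hconv, ?_⟩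
  · rintro x ⟨⟨c, hc0, rfl⟩, hx⟩
    refine mem_hull3.2 ⟨fun k => ∑ j, c j * (s k * B k j), fun k => ?_, ?_, ?_⟩
    · exact Finset.sum_nonneg fun j _ => mul_nonneg (hc0 j) (mul_nonneg (hs k).le (h.2.1 k j))
    · rw [← hx.2]
      simp only [hPv, Finset.mul_sum]
      rw [Finset.sum_comm (s := (Finset.univ : Finset (Fin m)))]
      rw [Finset.sum_comm]
      refine Finset.sum_congr rfl fun j _ => ?_
      rw [Finset.sum_comm]
      refine Finset.sum_congr rfl fun k _ => ?_
      simp only [← mul_assoc]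
      rw [← Finset.mul_sum, hvs, mul_one]
    · ext i
      simp only [Finset.sum_apply, Pi.smul_apply, smul_eq_mul, hPv, Finset.mul_sum, Finset.sum_mul]
      rw [Finset.sum_comm]
      exact Finset.sum_congr rfl fun j _ => Finset.sum_congr rfl fun k _ => by ring
  · rintro _ ⟨k, rfl⟩; exact hvspan k
  rcases hg with ⟨k, i, i', l, r, z, z', hne⟩ | ⟨k, j, j', l, r, z, z', hne⟩
  · left
    have hkl : l ≠ k := by rintro rfl; rw [z, z'] at hne; simp at hne
    have hkr : r ≠ k := by rintro rfl; rw [z, z'] at hne; simp at hne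
    have hlr : l ≠ r := by rintro rfl; exact hne rfl
    have huniv : (Finset.univ : Finset (Fin 3)) = {k, l, r} := by
      clear * - hkl hkr hlr; revert k l r; decide
    have hsum : ∀ f : Fin 3 → ℝ, ∑ k, f k = f k + f l + f r := fun f => by
      rw [huniv, Finset.sum_insert (by simp [hkl.symm, hkr.symm]), Finset.sum_pair hlr]; ring
    have key : ∀ x ∈ spanSimplex P, x i = 0 → x i' = 0 → x = v k := by
      rintro x ⟨hx, hx0, hx1⟩ e e'
      rw [hspan, SetLike.mem_coe, Submodule.mem_span_range_iff_exists_fun] at hx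
      obtain ⟨c, rfl⟩ := hx
      have ev : ∀ i, (∑ k, c k • A.col k) i = c k * A i k + c l * A i l + c r * A i r := fun i => by
        rw [Finset.sum_apply, hsum]; rfl
      rw [ev, z] at e
      rw [ev, z'] at e'
      have d : A i l * A i' r - A i r * A i' l ≠ 0 := sub_ne_zero.2 hne
      have cl : c l = 0 := by
        have : c l * (A i l * A i' r - A i r * A i' l) = 0 := by
          linear_combination A i' r * e - A i r * e'
        exact (mul_eq_zero.1 this).resolve_right d
      have cr : c r = 0 := by
        have : c r * (A i l * A i' r - A i r * A i' l) = 0 := by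
          linear_combination A i l * e' - A i' l * e
        exact (mul_eq_zero.1 this).resolve_right d
      simp only [ev, cl, cr, zero_mul, add_zero, ← Finset.mul_sum, hse] at hx1
      ext i
      rw [ev, cl, cr, hvA]
      linear_combination (v k i) * hx1
    have vi : v k i = 0 := by
      have := hvA i k; rw [z] at this
      exact (mul_eq_zero.1 this.symm).resolve_left (hs k).ne'
    have vi' : v k i' = 0 := by
      have := hvA i' k; rw [z'] at this
      exact (mul_eq_zero.1 this.symm).resolve_left (hs k).ne'
    have aux : ∀ x ∈ spanSimplex P, ∀ y ∈ spanSimplex P, v k ∈ openSegment ℝ x y → x = v k := by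
      rintro x hx y hy ⟨a, b, ha, hb, hab, he⟩
      have hz : ∀ i, v k i = 0 → x i = 0 := by
        intro i hi
        have h1 := congrFun he i
        simp only [Pi.add_apply, Pi.smul_apply, smul_eq_mul, hi] at h1
        have h2 := mul_nonneg ha.le (hx.2.1 i)
        have h3 := mul_nonneg hb.le (hy.2.1 i)
        have h4 : a * x i = 0 := by linarith
        exact (mul_eq_zero.1 h4).resolve_left ha.ne'
      exact key x hx (hz i vi) (hz i' vi')
    exact ⟨k, hvspan k, fun x hx y hy hxy => aux x hx y hy hxy⟩
  · right
    simp only [Matrix.transpose_apply] at z z' hne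
    have hkl : l ≠ k := by rintro rfl; rw [z, z'] at hne; simp at hne
    have hkr : r ≠ k := by rintro rfl; rw [z, z'] at hne; simp at hne
    have hlr : l ≠ r := by rintro rfl; exact hne rfl
    have huniv : (Finset.univ : Finset (Fin 3)) = {k, l, r} := by
      clear * - hkl hkr hlr; revert k l r; decide
    have hsum : ∀ f : Fin 3 → ℝ, ∑ k, f k = f k + f l + f r := fun f => by
      rw [huniv, Finset.sum_insert (by simp [hkl.symm, hkr.symm]), Finset.sum_pair hlr]; ring
    have hws : ∀ j, ∑ i, P i j = ∑ k, s k * B k j := fun j => by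
      simp only [hPv]
      rw [Finset.sum_comm]
      refine Finset.sum_congr rfl fun k _ => ?_
      rw [← Finset.mul_sum, hvs, mul_one]
    have hseg : ∀ j, B k j = 0 → vertexB P j ∈ segment ℝ (v l) (v r) := by
      intro j hj
      have hw := colsum_pos hP hcol j
      have hw' := hws j
      rw [hsum, hj] at hw'
      refine ⟨s l * B l j / ∑ i, P i j, s r * B r j / ∑ i, P i j, ?_, ?_, ?_, ?_⟩
      · exact div_nonneg (mul_nonneg (hs l).le (h.2.1 _ _)) hw.le
      · exact div_nonneg (mul_nonneg (hs r).le (h.2.1 _ _)) hw.le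
      · rw [← add_div, div_eq_one_iff_eq hw.ne']; linarith
      · ext i
        have := hPv i j
        rw [hsum, hj] at this
        simp only [Pi.add_apply, Pi.smul_apply, smul_eq_mul, vertexB]
        rw [this]
        ring
    refine ⟨l, r, j, j', hlr, fun heq => hne ?_, hseg j z, hseg j' z'⟩
    have hw := (colsum_pos hP hcol j).ne'
    have hw' := (colsum_pos hP hcol j').ne'
    have hB : ∀ q, (∑ i, P i j') * B q j = (∑ i, P i j) * B q j' := by
      have hz : ∑ q, ((∑ i, P i j') * B q j - (∑ i, P i j) * B q j') • A.col q = 0 := by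
        ext i
        have e1 := congrFun heq i
        simp only [vertexB] at e1
        rw [div_eq_div_iff hw hw'] at e1
        have p1 : P i j = ∑ q, A i q * B q j := by rw [h.2.2, Matrix.mul_apply]
        have p2 : P i j' = ∑ q, A i q * B q j' := by rw [h.2.2, Matrix.mul_apply]
        have e2 : (∑ q, ((∑ i, P i j') * B q j - (∑ i, P i j) * B q j') • A.col q) i
            = (∑ i, P i j') * ∑ q, A i q * B q j - (∑ i, P i j) * ∑ q, A i q * B q j' := by
          rw [Finset.sum_apply, Finset.mul_sum, Finset.mul_sum, ← Finset.sum_sub_distrib]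
          refine Finset.sum_congr rfl fun q _ => ?_
          simp only [Pi.smul_apply, Matrix.col_apply, smul_eq_mul]
          ring
        rw [e2, ← p1, ← p2, Pi.zero_apply]
        linarith
      intro q
      have := Fintype.linearIndependent_iff.1 hli _ hz q
      linarith
    have b1 := hB l
    have b2 := hB r
    have : (∑ i, P i j') * (∑ i, P i j) * (B l j * B r j' - B r j * B l j') = 0 := by
      linear_combination (∑ i, P i j) * B r j' * b1 - (∑ i, P i j) * B l j' * b2
    have := (mul_eq_zero.1 this).resolve_left (mul_ne_zero hw' hw)
    linarith

theorem stmt_7 (m n : ℕ) (P : Matrix (Fin m) (Fin n) ℝ)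
    (hP : ∀ i j, 0 ≤ P i j) (hcol : ∀ j, ∃ i, P i j ≠ 0) :
    (∃ (A : Matrix (Fin m) (Fin 3) ℝ) (B : Matrix (Fin 3) (Fin n) ℝ),
        (∀ i k, 0 ≤ A i k) ∧ (∀ k j, 0 ≤ B k j) ∧ P = A * B)
      ↔ (P.rank < 3 ∨
          (P.rank = 3 ∧ ∃ v : Fin 3 → (Fin m → ℝ), AffineIndependent ℝ v ∧
            coneSimplex P ⊆ convexHull ℝ (Set.range v) ∧
            convexHull ℝ (Set.range v) ⊆ spanSimplex P ∧
            ((∃ i : Fin 3, v i ∈ Set.extremePoints ℝ (spanSimplex P)) ∨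
              (∃ (i k : Fin 3) (j₁ j₂ : Fin n), i ≠ k ∧ vertexB P j₁ ≠ vertexB P j₂ ∧
                vertexB P j₁ ∈ segment ℝ (v i) (v k) ∧
                vertexB P j₂ ∈ segment ℝ (v i) (v k))))) := by
  constructor
  · rintro ⟨A, B, h⟩
    have h' : NF P A B := h
    have h3 : P.rank ≤ 3 := by
      rw [h'.2.2]
      refine (Matrix.rank_mul_le_left A B).trans ?_
      have := A.rank_le_width
      simpa using this
    rcases h3.lt_or_eq with hlt | heq
    · exact Or.inl hlt
    · obtain ⟨A', B', hN, hg⟩ := goodExists heq hP hcol ⟨A, B, h'⟩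
      exact Or.inr ⟨heq, forward heq hP hcol hN hg⟩
  · rintro (hlt | ⟨-, v, -, h1, h2, -⟩)
    · exact lowrank hP hcol hlt
    · exact backward hP hcol v h1 h2
end
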